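/- arXiv:2206.04353 — 2 statements merged into one kernel-verified Lean document; each statement's English description precedes it below -/
import Mathlib

section
/- Let N ≥ 1 be an integer, s ∈ (0,1), and 1 < p ≤ 1 + 2s/N. Then E_1^+ = {0}: every nonnegative u ∈ C(cl(ℝ^{N+1}_+)∖{0}) ∩ C²(ℝ^{N+1}_+) that is positively homogeneous of degree -2s/(p-1), satisfies div(z^{1-2s}∇u) = 0 in ℝ^{N+1}_+ and ∂_{ν^s}u(x,0) + u(x,0)^p = 0 for every x ∈ ℝ^N∖{0}, is identically zero. -/
open MeasureTheory Filter Topology Set Metric Asymptotics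

noncomputable section

/-- Euclidean space `ℝ^N`. -/
abbrev Euc (N : ℕ) : Type := EuclideanSpace ℝ (Fin N)

/-- Second derivative of `u` at `q` in the direction `v`. -/
noncomputable def d2 {N : ℕ} (u : Euc N × ℝ → ℝ) (q v : Euc N × ℝ) : ℝ :=
  fderiv ℝ (fun w => fderiv ℝ u w v) q v

/-- The Caffarelli–Silvestre operator `div(z^{1-2s} ∇u)` written out pointwise:
`z^{1-2s} Δu + (1-2s) z^{-2s} ∂_z u`. -/
noncomputable def CSop (N : ℕ) (s : ℝ) (u : Euc N × ℝ → ℝ) (q : Euc N × ℝ) : ℝ :=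
  q.2 ^ (1 - 2*s) *
      ((∑ i : Fin N, d2 u q (EuclideanSpace.single i (1:ℝ), (0:ℝ))) +
        d2 u q ((0 : Euc N), (1:ℝ)))
    + (1 - 2*s) * q.2 ^ (-(2*s)) * fderiv ℝ u q ((0 : Euc N), (1:ℝ))

/-- The normalizing constant `C_{N,s}` of the Poisson kernel, determined by
`C_{N,s} ∫ (|y|²+1)^{-(N+2s)/2} dy = 1`. -/
noncomputable def PoissonConst (N : ℕ) (s : ℝ) : ℝ :=
  (∫ y : Euc N, (‖y‖^2 + 1) ^ (-((N:ℝ) + 2*s)/2))⁻¹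

/-- The normalizing constant `c_{N,s}` of the fractional Laplacian. -/
noncomputable def cNs (N : ℕ) (s : ℝ) : ℝ :=
  2 ^ (2*s) * Real.pi ^ (-(N:ℝ)/2) * Real.Gamma (((N:ℝ) + 2*s)/2) / Real.Gamma (1 - s)

/-- The truncated integral appearing in the principal-value definition of `(-Δ)^s`. -/
noncomputable def fLapApprox (N : ℕ) (s : ℝ) (w : Euc N → ℝ) (x : Euc N) (ε : ℝ) : ℝ :=
  cNs N s * ∫ y in {y : Euc N | ε < dist x y}, (w x - w y) / dist x y ^ ((N:ℝ) + 2*s)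

/-- `(-Δ)^s w (x) = L` in the principal-value sense. -/
def HasFracLap (N : ℕ) (s : ℝ) (w : Euc N → ℝ) (x : Euc N) (L : ℝ) : Prop :=
  Tendsto (fLapApprox N s w x) (𝓝[>] (0:ℝ)) (𝓝 L)

/-- The fractional Laplacian `(-Δ)^s w (x)`, as a limit (junk value if the limit
does not exist). -/
noncomputable def fracLap (N : ℕ) (s : ℝ) (w : Euc N → ℝ) (x : Euc N) : ℝ :=
  limUnder (𝓝[>] (0:ℝ)) (fLapApprox N s w x)

/-- `w ∈ L¹_{μ_s}(ℝ^N)`, where `μ_s(x) = (1+|x|)^{-N-2s}`. -/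
def L1mu (N : ℕ) (s : ℝ) (w : Euc N → ℝ) : Prop :=
  Integrable (fun x : Euc N => w x * (1 + ‖x‖) ^ (-((N:ℝ) + 2*s)))

/-- The set `E_ε` of self-similar solutions of the lifted fractional Emden equation:
continuous on the closed half-space minus the origin, `C²` in the open half-space,
positively homogeneous of degree `-2s/(p-1)`, satisfying `div(z^{1-2s}∇u) = 0`
in the open half-space, and `∂_{ν^s}u(x,0) + ε|u(x,0)|^{p-1}u(x,0) = 0` for `x ≠ 0`,
where `∂_{ν^s}u(x,0) = -lim_{z→0⁺} z^{1-2s}∂_z u(x,z)`. -/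
def SelfSim (N : ℕ) (s p ε : ℝ) : Set (Euc N × ℝ → ℝ) :=
  {u | ContinuousOn u ({q : Euc N × ℝ | 0 ≤ q.2} \ {0}) ∧
       ContDiffOn ℝ 2 u {q : Euc N × ℝ | 0 < q.2} ∧
       (∀ l : ℝ, 0 < l → ∀ q : Euc N × ℝ, u (l • q.1, l * q.2) = l ^ (-(2*s)/(p-1)) * u q) ∧
       (∀ q : Euc N × ℝ, 0 < q.2 → CSop N s u q = 0) ∧
       (∀ x : Euc N, x ≠ 0 →
          Tendsto (fun z : ℝ => z ^ (1 - 2*s) * fderiv ℝ u (x, z) ((0 : Euc N), (1:ℝ)))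
            (𝓝[>] (0:ℝ)) (𝓝 (ε * |u (x, 0)| ^ (p-1) * u (x, 0))))}

/-- The subset `E_ε⁺` of nonnegative elements of `E_ε`. -/
def SelfSimPos (N : ℕ) (s p ε : ℝ) : Set (Euc N × ℝ → ℝ) :=
  {u ∈ SelfSim N s p ε | ∀ q : Euc N × ℝ, 0 ≤ q.2 → 0 ≤ u q}

/-- The constant `C_s(τ)` such that `(-Δ)^s |x|^τ = C_s(τ)|x|^{τ-2s}`. -/
noncomputable def Cs (N : ℕ) (s τ : ℝ) : ℝ :=
  2 ^ (2*s) * Real.Gamma (((N:ℝ) + τ)/2) * Real.Gamma ((2*s - τ)/2) /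
    (Real.Gamma (-τ/2) * Real.Gamma (((N:ℝ) - 2*s + τ)/2))

/-- The constant `c_p = C_s(-2s/(p-1))^{1/(p-1)}`. -/
noncomputable def cp (N : ℕ) (s p : ℝ) : ℝ := (Cs N s (-(2*s)/(p-1))) ^ (1/(p-1))

end

/-- A function of one variable with a local minimum at `0` has nonnegative second derivative
there. -/
theorem second_deriv_nonneg_of_isLocalMin {f f' : ℝ → ℝ} {D : ℝ}
    (hf : ∀ᶠ t in 𝓝 0, HasDerivAt f (f' t) t) (hf' : HasDerivAt f' D 0)
    (hmin : IsLocalMin f 0) : f' 0 = 0 ∧ 0 ≤ D := by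
  have h0 : f' 0 = 0 := hmin.hasDerivAt_eq_zero hf.self_of_nhds
  refine ⟨h0, ?_⟩
  by_contra! hD
  have hslope := hasDerivAt_iff_tendsto_slope.1 hf'
  have hneg : ∀ᶠ t in 𝓝[≠] (0:ℝ), slope f' 0 t < 0 := hslope.eventually_lt_const hD
  rw [eventually_nhdsWithin_iff] at hneg
  obtain ⟨r, hr, hball⟩ := Metric.eventually_nhds_iff.1 (hneg.and (hf.and hmin))
  have hin : ∀ t ∈ Icc (0:ℝ) (r/2), dist t 0 < r := by
    intro t ht
    rw [Real.dist_eq, sub_zero, abs_of_nonneg ht.1]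
    linarith [ht.2]
  have hanti : StrictAntiOn f (Icc 0 (r/2)) := by
    apply strictAntiOn_of_deriv_neg (convex_Icc _ _)
    · exact fun t ht => (hball (hin t ht)).2.1.continuousAt.continuousWithinAt
    · intro t ht
      rw [interior_Icc] at ht
      have hb := hball (hin t ⟨ht.1.le, ht.2.le⟩)
      rw [hb.2.1.deriv]
      have h1 := hb.1 ht.1.ne'
      rw [slope_def_field, h0, sub_zero, sub_zero, div_lt_iff₀ ht.1, zero_mul] at h1
      exact h1
  have h1 := hanti (left_mem_Icc.2 (by positivity)) (right_mem_Icc.2 (by positivity))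
    (by positivity : (0:ℝ) < r/2)
  have h2 := (hball (hin (r/2) ⟨by positivity, le_rfl⟩)).2.2
  linarith

/-- Comparison of first and second directional derivatives at a point where `u - g` has a
local minimum along a line. -/
theorem d2_ge_of_isLocalMin_line {N : ℕ} {u : Euc N × ℝ → ℝ} {q v : Euc N × ℝ}
    (hu : ContDiffAt ℝ 2 u q) {g g' : ℝ → ℝ} {D : ℝ}
    (hg : ∀ᶠ t in 𝓝 0, HasDerivAt g (g' t) t) (hg' : HasDerivAt g' D 0)
    (hmin : IsLocalMin (fun t : ℝ => u (q + t • v) - g t) 0) :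
    fderiv ℝ u q v = g' 0 ∧ D ≤ d2 u q v := by
  have hline : ∀ t : ℝ, HasDerivAt (fun t : ℝ => q + t • v) v t := fun t => by
    simpa using ((hasDerivAt_id t).smul_const v).const_add q
  have hq0 : q + (0:ℝ) • v = q := by simp
  have hdiff : ∀ᶠ p in 𝓝 q, DifferentiableAt ℝ u p := by
    filter_upwards [hu.eventually (by simp)] with p hp
    exact hp.differentiableAt (by norm_num)
  have hcont : Tendsto (fun t : ℝ => q + t • v) (𝓝 0) (𝓝 q) := by
    simpa using (hline 0).continuousAt.tendsto
  have h1 : ∀ᶠ t in 𝓝 (0:ℝ), HasDerivAt (fun t : ℝ => u (q + t • v) - g t)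
      (fderiv ℝ u (q + t • v) v - g' t) t := by
    filter_upwards [hcont.eventually hdiff, hg] with t ht hgt
    exact (ht.hasFDerivAt.comp_hasDerivAt t (hline t)).sub hgt
  have hfd : DifferentiableAt ℝ (fun w => fderiv ℝ u w v) q :=
    (((hu.fderiv_right (m := 1) (by norm_num)).differentiableAt (by norm_num)).clm_apply
      (differentiableAt_const v))
  have h2 : HasDerivAt (fun t : ℝ => fderiv ℝ u (q + t • v) v - g' t) (d2 u q v - D) 0 := by
    have := hfd.hasFDerivAt
    rw [← hq0] at this
    have h3 := (this.comp_hasDerivAt (0:ℝ) (hline 0)).sub hg'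
    rw [hq0] at h3
    exact h3
  obtain ⟨ha, hb⟩ := second_deriv_nonneg_of_isLocalMin h1 h2 hmin
  rw [hq0] at ha
  exact ⟨by linarith, by linarith⟩

/-- If a solution of `div(z^{1-2s}∇u) = 0` is touched from below by a barrier of the form
`G(|x - x₁|², z)`, then the barrier is a supersolution at the contact point. -/
theorem barrier_le_zero_of_isLocalMin {N : ℕ} {s : ℝ} {u : Euc N × ℝ → ℝ}
    (hu : ContDiffOn ℝ 2 u {q : Euc N × ℝ | 0 < q.2})
    {q : Euc N × ℝ} (hq : 0 < q.2) (heq : CSop N s u q = 0) (x₁ : Euc N)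
    {G : ℝ → ℝ → ℝ} {Gρ Gz : ℝ → ℝ} {Gρρ Gzz : ℝ}
    (hρ : ∀ᶠ ρ in 𝓝 (‖q.1 - x₁‖^2), HasDerivAt (fun ρ => G ρ q.2) (Gρ ρ) ρ)
    (hρρ : HasDerivAt Gρ Gρρ (‖q.1 - x₁‖^2))
    (hz : ∀ᶠ z in 𝓝 q.2, HasDerivAt (fun z => G (‖q.1 - x₁‖^2) z) (Gz z) z)
    (hzz : HasDerivAt Gz Gzz q.2)
    (hmin : IsLocalMin (fun p : Euc N × ℝ => u p - G (‖p.1 - x₁‖^2) p.2) q) :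
    4 * ‖q.1 - x₁‖^2 * Gρρ + 2 * N * Gρ (‖q.1 - x₁‖^2) + Gzz
      + (1 - 2*s) / q.2 * Gz q.2 ≤ 0 := by
  have huq : ContDiffAt ℝ 2 u q :=
    hu.contDiffAt ((isOpen_lt continuous_const continuous_snd).mem_nhds hq)
  have hminline : ∀ v : Euc N × ℝ, IsLocalMin (fun t : ℝ => u (q + t • v)
      - G (‖(q + t • v).1 - x₁‖^2) (q + t • v).2) 0 := by
    intro v
    have hc : Tendsto (fun t : ℝ => q + t • v) (𝓝 0) (𝓝 q) := by
      have : Continuous (fun t : ℝ => q + t • v) := by fun_prop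
      simpa using this.tendsto 0
    have := hc.eventually hmin
    simpa [IsLocalMin, IsMinFilter] using this
  set y : Euc N := q.1 - x₁ with hy
  have hx : ∀ i : Fin N, 4 * (y i)^2 * Gρρ + 2 * Gρ (‖y‖^2)
      ≤ d2 u q (EuclideanSpace.single i (1:ℝ), (0:ℝ)) := by
    intro i
    have hnorm : ∀ t : ℝ, ‖q.1 + t • EuclideanSpace.single i (1:ℝ) - x₁‖^2
        = ‖y‖^2 + 2 * t * y i + t^2 := by
      intro t
      have : q.1 + t • EuclideanSpace.single i (1:ℝ) - x₁
          = y + t • EuclideanSpace.single i (1:ℝ) := by rw [hy]; abel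
      rw [this, norm_add_sq_real, inner_smul_right, EuclideanSpace.inner_single_right, norm_smul]
      simp
      ring
    have hpoly : ∀ t : ℝ, HasDerivAt (fun t : ℝ => ‖y‖^2 + 2 * t * y i + t^2)
        (2 * y i + 2 * t) t := by
      intro t
      have := ((((hasDerivAt_id t).const_mul 2).mul_const (y i)).const_add (‖y‖^2)).add
        ((hasDerivAt_id t).pow 2)
      exact this.congr_deriv (by simp)
    have hpt : Tendsto (fun t : ℝ => ‖y‖^2 + 2 * t * y i + t^2) (𝓝 0) (𝓝 (‖y‖^2)) := by
      simpa using (hpoly 0).continuousAt.tendsto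
    have hg : ∀ᶠ t in 𝓝 (0:ℝ), HasDerivAt (fun t => G (‖y‖^2 + 2 * t * y i + t^2) q.2)
        (Gρ (‖y‖^2 + 2 * t * y i + t^2) * (2 * y i + 2 * t)) t := by
      filter_upwards [hpt.eventually hρ] with t ht
      exact HasDerivAt.comp t ht (hpoly t)
    have hp0 : ‖y‖^2 + 2 * 0 * y i + 0^2 = ‖y‖^2 := by ring
    have hg' : HasDerivAt (fun t => Gρ (‖y‖^2 + 2 * t * y i + t^2) * (2 * y i + 2 * t))
        (4 * (y i)^2 * Gρρ + 2 * Gρ (‖y‖^2)) 0 := by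
      have h1 : HasDerivAt (fun t => Gρ (‖y‖^2 + 2 * t * y i + t^2))
          (Gρρ * (2 * y i + 2 * 0)) 0 := by
        refine HasDerivAt.comp (0:ℝ) (h₂ := Gρ) ?_ (hpoly 0)
        rw [hp0]; exact hρρ
      have h2 : HasDerivAt (fun t : ℝ => 2 * y i + 2 * t) 2 0 := by
        simpa using ((hasDerivAt_id (0:ℝ)).const_mul 2).const_add (2 * y i)
      exact (h1.mul h2).congr_deriv (by rw [hp0]; ring)
    refine (d2_ge_of_isLocalMin_line huq hg hg' ?_).2
    have := hminline (EuclideanSpace.single i (1:ℝ), (0:ℝ))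
    simpa [hnorm] using this
  have hzdir : fderiv ℝ u q ((0 : Euc N), (1:ℝ)) = Gz q.2 ∧
      Gzz ≤ d2 u q ((0 : Euc N), (1:ℝ)) := by
    have hsh : ∀ t : ℝ, HasDerivAt (fun t : ℝ => q.2 + t) 1 t := fun t =>
      (hasDerivAt_id t).const_add q.2
    have hpt : Tendsto (fun t : ℝ => q.2 + t) (𝓝 0) (𝓝 q.2) := by
      simpa using (hsh 0).continuousAt.tendsto
    have hg : ∀ᶠ t in 𝓝 (0:ℝ), HasDerivAt (fun t => G (‖y‖^2) (q.2 + t)) (Gz (q.2 + t)) t := by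
      filter_upwards [hpt.eventually hz] with t ht
      exact (HasDerivAt.comp t ht (hsh t)).congr_deriv (mul_one _)
    have hg' : HasDerivAt (fun t => Gz (q.2 + t)) Gzz 0 := by
      have h := HasDerivAt.comp (0:ℝ) (h₂ := Gz) (h₂' := Gzz) (by simpa using hzz) (hsh 0)
      exact h.congr_deriv (mul_one _)
    have := d2_ge_of_isLocalMin_line (v := ((0 : Euc N), (1:ℝ))) huq hg hg' (by
      simpa [← hy] using hminline ((0 : Euc N), (1:ℝ)))
    simpa using this
  have hsum : 4 * ‖y‖^2 * Gρρ + 2 * N * Gρ (‖y‖^2)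
      ≤ ∑ i : Fin N, d2 u q (EuclideanSpace.single i (1:ℝ), (0:ℝ)) := by
    refine le_trans (le_of_eq ?_) (Finset.sum_le_sum fun i _ => hx i)
    rw [Finset.sum_add_distrib, EuclideanSpace.real_norm_sq_eq, ← Finset.sum_mul,
      ← Finset.mul_sum]
    simp
    ring
  unfold CSop at heq
  rw [hzdir.1] at heq
  have hpow : q.2 ^ (-(2*s)) = q.2 ^ (1 - 2*s) / q.2 := by
    rw [← Real.rpow_sub_one hq.ne']; congr 1; ring
  have hpos : 0 < q.2 ^ (1 - 2*s) := Real.rpow_pos_of_pos hq _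
  rw [hpow] at heq
  have h3 : q.2 ^ (1 - 2*s) * ((∑ i : Fin N, d2 u q (EuclideanSpace.single i (1:ℝ), (0:ℝ))) +
        d2 u q ((0 : Euc N), (1:ℝ)) + (1 - 2*s) / q.2 * Gz q.2) = 0 := by
    refine Eq.trans ?_ heq
    field_simp
  have h4 := (mul_eq_zero.1 h3).resolve_left hpos.ne'
  linarith [hzdir.2]

set_option maxHeartbeats 1000000 in
/-- Strong maximum principle: positivity at one interior point propagates horizontally. -/
theorem pos_of_pos_at_height {N : ℕ} {s : ℝ} {u : Euc N × ℝ → ℝ} (hs : s ∈ Set.Ioo (0:ℝ) 1)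
    (hu : ContDiffOn ℝ 2 u {q : Euc N × ℝ | 0 < q.2})
    (heq : ∀ q : Euc N × ℝ, 0 < q.2 → CSop N s u q = 0)
    (hnn : ∀ q : Euc N × ℝ, 0 < q.2 → 0 ≤ u q) {x₁ : Euc N} {z₁ : ℝ} (hz₁ : 0 < z₁)
    (hpos : 0 < u (x₁, z₁)) (x₂ : Euc N) : 0 < u (x₂, z₁) := by
  have huc : ContinuousOn u {q : Euc N × ℝ | 0 < q.2} := hu.continuousOn
  have hopen : IsOpen {q : Euc N × ℝ | 0 < q.2} := isOpen_lt continuous_const continuous_snd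
  set m := u (x₁, z₁) / 2 with hm
  have hm0 : 0 < m := by positivity
  obtain ⟨e, he, hball⟩ : ∃ e > 0, ∀ p : Euc N × ℝ, dist p (x₁, z₁) < e → m < u p := by
    have h1 : ∀ᶠ p in 𝓝 (x₁, z₁), m < u p :=
      (huc.continuousAt (hopen.mem_nhds hz₁)).eventually (lt_mem_nhds (by linarith))
    simpa using Metric.eventually_nhds_iff.1 h1
  set b := ‖x₂ - x₁‖^2 with hb
  have hb0 : 0 ≤ b := by positivity
  set a := z₁^2 / (8 * (b + 1) + z₁^2) with ha
  have ha0 : 0 < a := by positivity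
  have ha1 : a ≤ 1 := by
    rw [ha, div_le_one (by positivity)]; nlinarith
  have hab : a * b ≤ z₁^2 / 8 := by
    rw [ha, div_mul_eq_mul_div, div_le_iff₀ (by positivity)]
    nlinarith [mul_nonneg (sq_nonneg z₁) (sq_nonneg z₁)]
  set R := z₁^2 / 4 with hR
  set η := a * e^2 / 2 with hη
  have hη0 : 0 < η := by positivity
  set d : Euc N × ℝ → ℝ := fun p => a * ‖p.1 - x₁‖^2 + (p.2 - z₁)^2 with hd
  have hdc : Continuous d := by fun_prop
  set K := (2 * N * a + 5) / (4 * a * η) with hK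
  have hK0 : 0 < K := by positivity
  have hKη : K * (4 * a * η) = 2 * N * a + 5 := by
    rw [hK]; field_simp
  have hheight : ∀ p, d p ≤ R → |p.2 - z₁| ≤ z₁ / 2 := by
    intro p hp
    refine abs_le_of_sq_le_sq ?_ (by positivity)
    have : 0 ≤ a * ‖p.1 - x₁‖^2 := by positivity
    simp only [hd] at hp
    nlinarith
  have hD : IsCompact {p | d p ≤ R} := by
    refine IsCompact.of_isClosed_subset ((isCompact_closedBall x₁ (√(R / a))).prod
      (isCompact_Icc (a := z₁ / 2) (b := 3 * z₁ / 2))) (isClosed_le hdc continuous_const) ?_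
    intro p hp
    have h1 := abs_le.1 (hheight p hp)
    refine ⟨?_, by linarith [h1.1], by linarith [h1.2]⟩
    rw [mem_closedBall, dist_eq_norm]
    apply Real.le_sqrt_of_sq_le
    rw [le_div_iff₀ ha0]
    have : d p ≤ R := hp
    simp only [hd] at this
    nlinarith [sq_nonneg (p.2 - z₁)]
  have hDpos : ∀ p, d p ≤ R → 0 < p.2 := fun p hp => by
    linarith [(abs_le.1 (hheight p hp)).1]
  set G : ℝ → ℝ → ℝ := fun ρ z =>
    m * (Real.exp (-K * (a * ρ + (z - z₁)^2)) - Real.exp (-K * R)) with hG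
  set v : Euc N × ℝ → ℝ := fun p => u p - G (‖p.1 - x₁‖^2) p.2 with hv
  have hvc : ContinuousOn v {p | d p ≤ R} := by
    refine (huc.mono fun p hp => hDpos p hp).sub (Continuous.continuousOn ?_)
    simp only [hG]; fun_prop
  have hx2 : d (x₂, z₁) < R := by
    simp only [hd, hR, ← hb]
    nlinarith [sq_pos_of_pos hz₁]
  obtain ⟨q, hqD, hqmin⟩ := hD.exists_isMinOn ⟨(x₂, z₁), hx2.le⟩ hvc
  have hGd : ∀ p : Euc N × ℝ, G (‖p.1 - x₁‖^2) p.2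
      = m * (Real.exp (-K * d p) - Real.exp (-K * R)) := fun p => rfl
  have hvq : 0 ≤ v q := by
    by_cases h1 : d q ≤ η
    · have hd1 : dist q (x₁, z₁) < e := by
        rw [Prod.dist_eq, max_lt_iff, dist_eq_norm, Real.dist_eq]
        simp only [hd, hη] at h1
        constructor
        · refine lt_of_pow_lt_pow_left₀ 2 he.le ?_
          have : a * ‖q.1 - x₁‖^2 < a * e^2 := by
            nlinarith [sq_nonneg (q.2 - z₁), mul_pos ha0 (sq_pos_of_pos he)]
          exact lt_of_mul_lt_mul_left this ha0.le
        · refine abs_lt_of_sq_lt_sq ?_ he.le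
          have : 0 ≤ a * ‖q.1 - x₁‖^2 := by positivity
          nlinarith [sq_pos_of_pos he]
      have h2 := hball q hd1
      have h3 : Real.exp (-K * d q) ≤ 1 := by
        rw [Real.exp_le_one_iff]
        have : 0 ≤ d q := by positivity
        nlinarith
      simp only [hv, hGd]
      nlinarith [Real.exp_pos (-K * R)]
    · push Not at h1
      by_cases h2 : d q = R
      · simp only [hv, hGd, h2, sub_self, mul_zero, sub_zero]
        exact hnn q (hDpos q hqD)
      · exfalso
        have hlt : d q < R := lt_of_le_of_ne hqD h2
        have hq0 := hDpos q hqD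
        have hloc : IsLocalMin v q :=
          hqmin.isLocalMin (mem_of_superset ((isOpen_lt hdc continuous_const).mem_nhds hlt)
            fun p (hp : d p < R) => show d p ≤ R from hp.le)
        have hexp1 : ∀ ρ, HasDerivAt (fun ρ => Real.exp (-K * (a * ρ + (q.2 - z₁)^2)))
            (-K * a * Real.exp (-K * (a * ρ + (q.2 - z₁)^2))) ρ := by
          intro ρ
          have := ((((hasDerivAt_id ρ).const_mul a).add_const ((q.2 - z₁)^2)).const_mul (-K)).exp
          exact this.congr_deriv (by simp; ring)
        have hexp2 : ∀ z, HasDerivAt (fun z => Real.exp (-K * (a * ‖q.1 - x₁‖^2 + (z - z₁)^2)))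
            (-2 * K * (z - z₁) * Real.exp (-K * (a * ‖q.1 - x₁‖^2 + (z - z₁)^2))) z := by
          intro z
          have := (((((hasDerivAt_id z).sub_const z₁).pow 2).const_add
            (a * ‖q.1 - x₁‖^2)).const_mul (-K)).exp
          exact this.congr_deriv (by simp; ring)
        have key := barrier_le_zero_of_isLocalMin (G := G) (x₁ := x₁)
          (Gρ := fun ρ => m * (-K * a * Real.exp (-K * (a * ρ + (q.2 - z₁)^2))))
          (Gz := fun z => m * (-2 * K * (z - z₁) *
            Real.exp (-K * (a * ‖q.1 - x₁‖^2 + (z - z₁)^2))))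
          (Gρρ := m * (-K * a * (-K * a * Real.exp (-K * (a * ‖q.1 - x₁‖^2 + (q.2 - z₁)^2)))))
          (Gzz := m * ((-2 * K) * Real.exp (-K * (a * ‖q.1 - x₁‖^2 + (q.2 - z₁)^2)) +
            -2 * K * (q.2 - z₁) * (-2 * K * (q.2 - z₁) *
              Real.exp (-K * (a * ‖q.1 - x₁‖^2 + (q.2 - z₁)^2)))))
          hu hq0 (heq q hq0)
          (Eventually.of_forall fun ρ => ((hexp1 ρ).sub_const _).const_mul m)
          (((hexp1 _).const_mul _).const_mul m)
          (Eventually.of_forall fun z => ((hexp2 z).sub_const _).const_mul m)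
          (by
            have h := ((((hasDerivAt_id q.2).sub_const z₁).const_mul (-2 * K)).mul
              (hexp2 q.2)).const_mul m
            exact h.congr_deriv (by simp))
          hloc
        set E := Real.exp (-K * (a * ‖q.1 - x₁‖^2 + (q.2 - z₁)^2)) with hE
        have hE0 : 0 < E := Real.exp_pos _
        set w := (q.2 - z₁) / q.2 with hw
        have hab := abs_le.1 (hheight q hqD)
        have hw1 : |w| ≤ 1 := by
          rw [hw, abs_div, abs_of_pos hq0, div_le_one hq0, abs_le]
          constructor <;> linarith [hab.1, hab.2]
        have hsw : (1 - 2*s) * w ≤ 1 := by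
          refine (le_abs_self _).trans ?_
          rw [abs_mul]
          have : |1 - 2*s| ≤ 1 := abs_le.2 ⟨by linarith [hs.2], by linarith [hs.1]⟩
          exact mul_le_one₀ this (abs_nonneg _) hw1
        have hid : 4 * ‖q.1 - x₁‖^2 * (m * (-K * a * (-K * a * E))) + 2 * N * (m * (-K * a * E))
            + m * ((-2 * K) * E + -2 * K * (q.2 - z₁) * (-2 * K * (q.2 - z₁) * E))
            + (1 - 2*s) / q.2 * (m * (-2 * K * (q.2 - z₁) * E))
            = m * E * K * (K * (4 * a^2 * ‖q.1 - x₁‖^2 + 4 * (q.2 - z₁)^2)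
              - 2 * N * a - 2 - 2 * ((1 - 2*s) * w)) := by
          rw [hw]; field_simp; ring
        rw [hid] at key
        have hlow : 4 * a * η < 4 * a^2 * ‖q.1 - x₁‖^2 + 4 * (q.2 - z₁)^2 := by
          have h3 : 4 * a * η < 4 * a * d q := mul_lt_mul_of_pos_left h1 (by positivity)
          refine h3.trans_le ?_
          simp only [hd]
          nlinarith [mul_nonneg (sub_nonneg.2 ha1) (sq_nonneg (q.2 - z₁))]
        have h4 := mul_lt_mul_of_pos_left hlow hK0
        have h5 : 0 < m * E * K := by positivity
        have := nonpos_of_mul_nonpos_right key h5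
        linarith
  have hfin : 0 ≤ v (x₂, z₁) := hvq.trans (hqmin hx2.le)
  simp only [hv, hGd] at hfin
  have : Real.exp (-K * R) < Real.exp (-K * d (x₂, z₁)) := by
    rw [Real.exp_lt_exp]; nlinarith
  nlinarith

/-- A function with prescribed weighted conormal derivative grows like `z^{2s}` off the
boundary. -/
theorem tendsto_div_rpow_of_conormal {f f' : ℝ → ℝ} {s L : ℝ} (hs : 0 < s)
    (hf : ∀ z, 0 < z → HasDerivAt f (f' z) z) (hc : Tendsto f (𝓝[>] 0) (𝓝 (f 0)))
    (hL : Tendsto (fun z => z ^ (1 - 2*s) * f' z) (𝓝[>] 0) (𝓝 L)) :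
    Tendsto (fun z => (f z - f 0) / z ^ (2*s)) (𝓝[>] 0) (𝓝 (L / (2*s))) := by
  have hself : ∀ᶠ z : ℝ in 𝓝[>] 0, 0 < z := self_mem_nhdsWithin
  refine HasDerivAt.lhopital_zero_nhdsGT (f' := f') (g' := fun z => 2*s * z ^ (2*s - 1))
    ?_ ?_ ?_ ?_ ?_ ?_
  · filter_upwards [hself] with z hz using (hf z hz).sub_const _
  · filter_upwards [hself] with z hz using Real.hasDerivAt_rpow_const (Or.inl hz.ne')
  · filter_upwards [hself] with z hz
    have := Real.rpow_pos_of_pos hz (2*s - 1)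
    positivity
  · simpa using hc.sub_const (f 0)
  · have := (Real.continuousAt_rpow_const (0:ℝ) (2*s) (Or.inr (by positivity))).tendsto
    rw [Real.zero_rpow (by positivity)] at this
    exact this.mono_left nhdsWithin_le_nhds
  · refine (hL.div_const (2*s)).congr' ?_
    filter_upwards [hself] with z hz
    have : z ^ (1 - 2*s) = (z ^ (2*s - 1))⁻¹ := by
      rw [← Real.rpow_neg hz.le]; congr 1; ring
    rw [this]
    have := (Real.rpow_pos_of_pos hz (2*s - 1)).ne'
    field_simp

/-- Boundary expansion of `u` along vertical lines in terms of its conormal derivative. -/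
theorem tendsto_vertical_div_rpow {N : ℕ} {s : ℝ} {u : Euc N × ℝ → ℝ} (hs : 0 < s)
    (hcont : ContinuousOn u ({q : Euc N × ℝ | 0 ≤ q.2} \ {0}))
    (hu : ContDiffOn ℝ 2 u {q : Euc N × ℝ | 0 < q.2}) {x : Euc N} (hx : x ≠ 0) {L : ℝ}
    (hL : Tendsto (fun z : ℝ => z ^ (1 - 2*s) * fderiv ℝ u (x, z) ((0 : Euc N), (1:ℝ)))
      (𝓝[>] (0:ℝ)) (𝓝 L)) :
    Tendsto (fun z => (u (x, z) - u (x, 0)) / z ^ (2*s)) (𝓝[>] 0) (𝓝 (L / (2*s))) := by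
  refine tendsto_div_rpow_of_conormal (f := fun z => u (x, z)) hs ?_ ?_ hL
  · intro z hz
    have h1 : ContDiffAt ℝ 2 u (x, z) :=
      hu.contDiffAt ((isOpen_lt continuous_const continuous_snd).mem_nhds hz)
    exact (h1.differentiableAt (by norm_num)).hasFDerivAt.comp_hasDerivAt z
      ((hasDerivAt_const z x).prodMk (hasDerivAt_id z))
  · have h1 : ContinuousWithinAt u ({q : Euc N × ℝ | 0 ≤ q.2} \ {0}) (x, 0) :=
      hcont _ ⟨le_refl (0:ℝ), fun h => hx (congrArg Prod.fst h)⟩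
    refine Tendsto.comp h1 (tendsto_nhdsWithin_iff.2 ⟨?_, ?_⟩)
    · exact ((Continuous.prodMk_right x).tendsto 0).mono_left nhdsWithin_le_nhds
    · filter_upwards [self_mem_nhdsWithin] with z hz
      exact ⟨show (0:ℝ) ≤ z from le_of_lt hz, fun h => hx (congrArg Prod.fst h)⟩

/-- Hopf's lemma: at a boundary zero of a positive solution the conormal derivative does not
vanish. -/
theorem conormal_pos_of_boundary_zero {N : ℕ} {s : ℝ} {u : Euc N × ℝ → ℝ}
    (hs : s ∈ Set.Ioo (0:ℝ) 1)
    (hcont : ContinuousOn u ({q : Euc N × ℝ | 0 ≤ q.2} \ {0}))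
    (hu : ContDiffOn ℝ 2 u {q : Euc N × ℝ | 0 < q.2})
    (heq : ∀ q : Euc N × ℝ, 0 < q.2 → CSop N s u q = 0)
    (hnn : ∀ q : Euc N × ℝ, 0 ≤ q.2 → 0 ≤ u q)
    (hpos : ∀ q : Euc N × ℝ, 0 < q.2 → 0 < u q) {x₁ : Euc N} (hx₁ : x₁ ≠ 0) {L : ℝ}
    (hL : Tendsto (fun z : ℝ => z ^ (1 - 2*s) * fderiv ℝ u (x₁, z) ((0 : Euc N), (1:ℝ)))
      (𝓝[>] (0:ℝ)) (𝓝 L)) (hzero : u (x₁, 0) = 0) : 0 < L := by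
  have hs0 : 0 < s := hs.1
  have hs1 : 0 < 1 - s := by linarith [hs.2]
  set ρ₀ := ‖x₁‖ / 2 with hρ₀
  have hρpos : 0 < ρ₀ := by have := norm_pos_iff.2 hx₁; positivity
  set A := (N + 1) / (1 - s) with hA
  have hA0 : 0 < A := by positivity
  have hAs : A * (1 - s) = N + 1 := by rw [hA]; field_simp
  obtain ⟨h, hh0, hhr⟩ : ∃ h > 0, ∀ z ∈ Icc (0:ℝ) h, z ^ (2*s) + A * z^2 < ρ₀^2 := by
    have h1 : ContinuousAt (fun z : ℝ => z ^ (2*s) + A * z^2) 0 :=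
      (Real.continuousAt_rpow_const (0:ℝ) (2*s) (Or.inr (by positivity))).add (by fun_prop)
    have h2 : ∀ᶠ z in 𝓝 (0:ℝ), z ^ (2*s) + A * z^2 < ρ₀^2 := by
      refine h1.eventually_lt_const ?_
      beta_reduce
      rw [Real.zero_rpow (by positivity)]
      simpa using pow_pos hρpos 2
    obtain ⟨r, hr, hb⟩ := Metric.eventually_nhds_iff.1 h2
    refine ⟨r / 2, by positivity, fun z hz => hb ?_⟩
    rw [Real.dist_eq, sub_zero, abs_of_nonneg hz.1]
    linarith [hz.2]
  have hne : ∀ x ∈ closedBall x₁ ρ₀, x ≠ 0 := by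
    rintro x hx rfl
    rw [mem_closedBall, dist_eq_norm, zero_sub, norm_neg] at hx
    linarith
  have hmem : ∀ q ∈ closedBall x₁ ρ₀ ×ˢ Icc (0:ℝ) h,
      q ∈ ({q : Euc N × ℝ | 0 ≤ q.2} \ {0}) := fun q hq =>
    ⟨hq.2.1, fun h0 => hne _ hq.1 (congrArg Prod.fst h0)⟩
  have hD : IsCompact (closedBall x₁ ρ₀ ×ˢ Icc (0:ℝ) h) :=
    (isCompact_closedBall _ _).prod isCompact_Icc
  obtain ⟨qt, hqt, hqtmin⟩ := ((isCompact_closedBall x₁ ρ₀).prod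
    (isCompact_singleton (x := h))).exists_isMinOn
    ⟨(x₁, h), mem_closedBall_self hρpos.le, rfl⟩
    (hcont.mono fun q hq => hmem q ⟨hq.1, by
      have : q.2 = h := hq.2
      rw [this]; exact right_mem_Icc.2 hh0.le⟩)
  have hqt2 : qt.2 = h := hqt.2
  have hm0 : 0 < u qt := hpos qt (by rw [hqt2]; exact hh0)
  set c := u qt / ρ₀^2 with hc
  have hc0 : 0 < c := by positivity
  have hcρ : c * ρ₀^2 = u qt := by rw [hc]; field_simp
  set G : ℝ → ℝ → ℝ := fun ρ z => c * (z ^ (2*s) + A * z^2 - ρ) with hG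
  set v : Euc N × ℝ → ℝ := fun p => u p - G (‖p.1 - x₁‖^2) p.2 with hv
  have hvc : ContinuousOn v (closedBall x₁ ρ₀ ×ˢ Icc (0:ℝ) h) := by
    refine (hcont.mono hmem).sub (Continuous.continuousOn ?_)
    have h1 : Continuous fun p : Euc N × ℝ => p.2 ^ (2*s) :=
      continuous_snd.rpow_const fun _ => Or.inr (by positivity)
    simp only [hG]
    fun_prop
  obtain ⟨q, hqD, hqmin⟩ := hD.exists_isMinOn
    ⟨(x₁, 0), mem_closedBall_self hρpos.le, left_mem_Icc.2 hh0.le⟩ hvc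
  have hqlt := hhr q.2 hqD.2
  have hu0 : 0 ≤ u q := hnn q hqD.2.1
  have hvq : 0 ≤ v q := by
    simp only [hv, hG]
    have hn0 : 0 ≤ ‖q.1 - x₁‖^2 := by positivity
    rcases hqD.2.1.eq_or_lt with h0 | h0
    · rw [← h0, Real.zero_rpow (by positivity)]
      nlinarith
    rcases hqD.2.2.eq_or_lt with h1 | h1
    · have : u qt ≤ u q := hqtmin ⟨hqD.1, h1⟩
      nlinarith
    rcases (mem_closedBall.1 hqD.1).eq_or_lt with h2 | h2
    · rw [← dist_eq_norm, h2]
      nlinarith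
    exfalso
    have hloc : IsLocalMin v q := by
      refine hqmin.isLocalMin ?_
      refine mem_of_superset (prod_mem_nhds (isOpen_ball.mem_nhds (mem_ball.2 h2))
        (isOpen_Ioo.mem_nhds ⟨h0, h1⟩)) (prod_mono ball_subset_closedBall Ioo_subset_Icc_self)
    have hpow : ∀ b z : ℝ, 0 < z → HasDerivAt (fun z : ℝ => z ^ b) (b * z ^ (b - 1)) z :=
      fun b z hz => Real.hasDerivAt_rpow_const (Or.inl hz.ne')
    have key := barrier_le_zero_of_isLocalMin (G := G) (x₁ := x₁)
      (Gρ := fun _ => -c) (Gρρ := 0)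
      (Gz := fun z => c * (2*s * z ^ (2*s - 1) + A * (2 * z)))
      (Gzz := c * (2*s * ((2*s - 1) * q.2 ^ (2*s - 1 - 1)) + A * 2))
      hu h0 (heq q h0)
      (Eventually.of_forall fun ρ => by
        have := (((hasDerivAt_id ρ).const_sub (q.2 ^ (2*s) + A * q.2^2)).const_mul c)
        exact this.congr_deriv (by ring))
      (hasDerivAt_const _ _)
      (by
        filter_upwards [lt_mem_nhds h0] with z hz
        have := (((hpow (2*s) z hz).add
          (((hasDerivAt_id z).pow 2).const_mul A)).sub_const (‖q.1 - x₁‖^2)).const_mul c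
        exact this.congr_deriv (by simp))
      (by
        have := (((hpow (2*s - 1) q.2 h0).const_mul (2*s)).add
          (((hasDerivAt_id q.2).const_mul 2).const_mul A)).const_mul c
        exact this.congr_deriv (by simp))
      hloc
    have hp1 : q.2 ^ (2*s - 1) = q.2 ^ (2*s - 1 - 1) * q.2 := by
      rw [← Real.rpow_add_one h0.ne']; congr 1; ring
    have hid : 4 * ‖q.1 - x₁‖^2 * 0 + 2 * N * (-c)
        + c * (2*s * ((2*s - 1) * q.2 ^ (2*s - 1 - 1)) + A * 2)
        + (1 - 2*s) / q.2 * (c * (2*s * q.2 ^ (2*s - 1) + A * (2 * q.2)))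
        = c * (4 * (A * (1 - s)) - 2 * N) := by
      rw [hp1]; field_simp; ring
    rw [hid, hAs] at key
    have : (0:ℝ) ≤ N := N.cast_nonneg
    nlinarith
  have hlim := tendsto_vertical_div_rpow hs0 hcont hu hx₁ hL
  have hge : c ≤ L / (2*s) := by
    refine ge_of_tendsto hlim ?_
    filter_upwards [self_mem_nhdsWithin, mem_nhdsWithin_of_mem_nhds (gt_mem_nhds hh0)]
      with z (hz0 : 0 < z) hzh
    have h1 : 0 ≤ v (x₁, z) :=
      hvq.trans (hqmin ⟨mem_closedBall_self hρpos.le, hz0.le, le_of_lt hzh⟩)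
    simp only [hv, hG, sub_self, norm_zero] at h1
    rw [hzero, sub_zero, le_div_iff₀ (Real.rpow_pos_of_pos hz0 _)]
    have : 0 ≤ A * z^2 := by positivity
    nlinarith
  rw [le_div_iff₀ (by positivity)] at hge
  exact lt_of_lt_of_le (by positivity) hge

/-- The profile `z^b (ρ + z²)^{-β}`, homogeneous of degree `b - 2β` when `ρ = |x|²`. -/
noncomputable def powerProfile (b β ρ z : ℝ) : ℝ := z ^ b * (ρ + z^2) ^ (-β)

theorem hasDerivAt_powerProfile_left (b β : ℝ) {ρ z : ℝ} (h : 0 < ρ + z^2) :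
    HasDerivAt (fun ρ => powerProfile b β ρ z) (-β * powerProfile b (β + 1) ρ z) ρ := by
  have h1 := (((hasDerivAt_id ρ).add_const (z^2)).rpow_const (p := -β)
    (Or.inl h.ne')).const_mul (z ^ b)
  refine h1.congr_deriv ?_
  simp only [powerProfile, id]
  rw [show -(β + 1) = -β - 1 by ring]
  ring

theorem hasDerivAt_powerProfile_right (b β : ℝ) {ρ z : ℝ} (hρ : 0 ≤ ρ) (hz : 0 < z) :
    HasDerivAt (fun z => powerProfile b β ρ z)
      (b * powerProfile (b - 1) β ρ z - 2 * β * powerProfile (b + 1) (β + 1) ρ z) z := by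
  have h : 0 < ρ + z^2 := by positivity
  have h1 : HasDerivAt (fun z => ρ + z^2) (2 * z) z := by
    exact (((hasDerivAt_id z).pow 2).const_add ρ).congr_deriv (by simp)
  have h2 := (Real.hasDerivAt_rpow_const (p := b) (Or.inl hz.ne')).mul
    (h1.rpow_const (p := -β) (Or.inl h.ne'))
  refine h2.congr_deriv ?_
  simp only [powerProfile]
  rw [show -(β + 1) = -β - 1 by ring, Real.rpow_add_one hz.ne']
  ring

/-- The degenerate operator applied to `powerProfile b β` with `b ∈ {0, 2s}`. -/
theorem operator_powerProfile (n s : ℝ) {b β ρ z : ℝ} (hb : b * (b - 2*s) = 0) (hρ : 0 ≤ ρ)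
    (hz : 0 < z) :
    4 * ρ * (-β * (-(β + 1) * powerProfile b (β + 1 + 1) ρ z))
      + 2 * n * (-β * powerProfile b (β + 1) ρ z)
      + (b * ((b - 1) * powerProfile (b - 1 - 1) β ρ z
            - 2 * β * powerProfile (b - 1 + 1) (β + 1) ρ z)
        - 2 * β * ((b + 1) * powerProfile (b + 1 - 1) (β + 1) ρ z
            - 2 * (β + 1) * powerProfile (b + 1 + 1) (β + 1 + 1) ρ z))
      + (1 - 2*s) / z * (b * powerProfile (b - 1) β ρ z
          - 2 * β * powerProfile (b + 1) (β + 1) ρ z)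
      = 2 * β * (2 * β - n - 2 * b + 2*s) * powerProfile b (β + 1) ρ z := by
  have hR : 0 < ρ + z^2 := by positivity
  set R := ρ + z^2 with hRdef
  have hρR : ρ = R - z^2 := by rw [hRdef]; ring
  simp only [powerProfile, ← hRdef]
  have e1 : R ^ (-β) = R ^ (-(β + 1 + 1)) * R^2 := by
    rw [← Real.rpow_add_natCast hR.ne']; congr 1; push_cast; ring
  have e2 : R ^ (-(β + 1)) = R ^ (-(β + 1 + 1)) * R := by
    rw [← Real.rpow_add_one hR.ne']; congr 1; ring
  have e3 : z ^ (b - 1) = z ^ (b - 1 - 1) * z := by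
    rw [← Real.rpow_add_one hz.ne']; congr 1; ring
  have e4 : z ^ b = z ^ (b - 1 - 1) * z^2 := by
    rw [← Real.rpow_add_natCast hz.ne']; congr 1; push_cast; ring
  have e5 : z ^ (b + 1) = z ^ (b - 1 - 1) * z^3 := by
    rw [← Real.rpow_add_natCast hz.ne']; congr 1; push_cast; ring
  have e6 : z ^ (b + 1 + 1) = z ^ (b - 1 - 1) * z^4 := by
    rw [← Real.rpow_add_natCast hz.ne']; congr 1; push_cast; ring
  rw [show b - 1 + 1 = b by ring, show b + 1 - 1 = b by ring, e1, e2, e5, e6, e4, e3, hρR]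
  field_simp
  linear_combination (R^2) * hb

theorem powerProfile_scale (b β : ℝ) {l ρ z : ℝ} (hl : 0 < l) (hρ : 0 ≤ ρ) (hz : 0 ≤ z) :
    powerProfile b β (l^2 * ρ) (l * z) = l ^ (b - 2*β) * powerProfile b β ρ z := by
  simp only [powerProfile]
  rw [show l^2 * ρ + (l * z)^2 = l^2 * (ρ + z^2) by ring,
    Real.mul_rpow hl.le hz, Real.mul_rpow (by positivity) (by positivity),
    ← Real.rpow_natCast_mul hl.le,
    show b - 2*β = b + ((2:ℕ):ℝ) * -β by push_cast; ring, Real.rpow_add hl]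
  ring

theorem one_sub_mul_le_one_add_rpow_neg {α t : ℝ} (hα : 0 ≤ α) (ht : 0 ≤ t) :
    1 - α * t ≤ (1 + t) ^ (-α) := by
  have h1 : 0 < 1 + t := by linarith
  rw [Real.rpow_def_of_pos h1]
  have h2 := Real.add_one_le_exp (Real.log (1 + t) * -α)
  have h3 := Real.log_le_sub_one_of_pos h1
  nlinarith

/-- The barrier `z^{2s} r^{-2α-2s} + δ r^{-2α}` on the half-space, `r² = |x|² + z²`. -/
noncomputable def homBarrier (s α δ ρ z : ℝ) : ℝ :=
  powerProfile (2*s) (α + s) ρ z + δ * powerProfile 0 α ρ z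

theorem homBarrier_pos {s α δ ρ z : ℝ} (hδ : 0 < δ) (hz : 0 ≤ z) (h : 0 < ρ + z^2) :
    0 < homBarrier s α δ ρ z := by
  have h1 := Real.rpow_nonneg hz (2*s)
  have h2 := Real.rpow_pos_of_pos h (-(α + s))
  have h3 := Real.rpow_pos_of_pos h (-α)
  simp only [homBarrier, powerProfile, Real.rpow_zero]
  positivity

theorem homBarrier_scale (s α δ : ℝ) {l ρ z : ℝ} (hl : 0 < l) (hρ : 0 ≤ ρ) (hz : 0 ≤ z) :
    homBarrier s α δ (l^2 * ρ) (l * z) = l ^ (-(2*α)) * homBarrier s α δ ρ z := by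
  simp only [homBarrier]
  rw [powerProfile_scale _ _ hl hρ hz, powerProfile_scale _ _ hl hρ hz,
    show 2*s - 2*(α + s) = -(2*α) by ring, show 0 - 2*α = -(2*α) by ring]
  ring

/-- A solution cannot touch a multiple of `homBarrier` from above at an interior point. -/
theorem not_isLocalMin_sub_homBarrier {N : ℕ} {s α δ c : ℝ} {u : Euc N × ℝ → ℝ}
    (hs : 0 < s) (hα : 0 < α) (hNα : N ≤ 2 * α) (hδ : 0 < δ) (hc : 0 < c)
    (hu : ContDiffOn ℝ 2 u {q : Euc N × ℝ | 0 < q.2})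
    {q : Euc N × ℝ} (hq : 0 < q.2) (heq : CSop N s u q = 0) :
    ¬ IsLocalMin (fun p : Euc N × ℝ => u p - c * homBarrier s α δ (‖p.1‖^2) p.2) q := by
  intro hmin
  set ρ := ‖q.1 - 0‖^2 with hρ
  have hρ0 : 0 ≤ ρ := by positivity
  have hR : 0 < ρ + q.2^2 := by positivity
  have hleft : ∀ b β, ∀ᶠ r in 𝓝 ρ, HasDerivAt (fun r => powerProfile b β r q.2)
      (-β * powerProfile b (β + 1) r q.2) r := by
    intro b β
    have : ∀ᶠ r in 𝓝 ρ, 0 < r + q.2^2 :=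
      (by fun_prop : ContinuousAt (fun r : ℝ => r + q.2^2) ρ).eventually (lt_mem_nhds hR)
    filter_upwards [this] with r hr using hasDerivAt_powerProfile_left b β hr
  have hright : ∀ b β, ∀ᶠ z in 𝓝 q.2, HasDerivAt (fun z => powerProfile b β ρ z)
      (b * powerProfile (b - 1) β ρ z - 2 * β * powerProfile (b + 1) (β + 1) ρ z) z := by
    intro b β
    filter_upwards [lt_mem_nhds hq] with z hz using hasDerivAt_powerProfile_right b β hρ0 hz
  have hleft2 : ∀ b β, HasDerivAt (fun r => -β * powerProfile b (β + 1) r q.2)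
      (-β * (-(β + 1) * powerProfile b (β + 1 + 1) ρ q.2)) ρ := fun b β =>
    (hleft b (β + 1)).self_of_nhds.const_mul (-β)
  have hright2 : ∀ b β, HasDerivAt
      (fun z => b * powerProfile (b - 1) β ρ z - 2 * β * powerProfile (b + 1) (β + 1) ρ z)
      (b * ((b - 1) * powerProfile (b - 1 - 1) β ρ q.2
            - 2 * β * powerProfile (b - 1 + 1) (β + 1) ρ q.2)
        - 2 * β * ((b + 1) * powerProfile (b + 1 - 1) (β + 1) ρ q.2
            - 2 * (β + 1) * powerProfile (b + 1 + 1) (β + 1 + 1) ρ q.2)) q.2 := fun b β =>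
    ((hright (b - 1) β).self_of_nhds.const_mul b).sub
      ((hright (b + 1) (β + 1)).self_of_nhds.const_mul (2 * β))
  have key := barrier_le_zero_of_isLocalMin (x₁ := 0)
    (G := fun ρ z => c * homBarrier s α δ ρ z) hu hq heq
    (by
      filter_upwards [hleft (2*s) (α + s), hleft 0 α] with r h1 h2
      exact (h1.add (h2.const_mul δ)).const_mul c)
    (((hleft2 (2*s) (α + s)).add ((hleft2 0 α).const_mul δ)).const_mul c)
    (by
      filter_upwards [hright (2*s) (α + s), hright 0 α] with z h1 h2
      exact (h1.add (h2.const_mul δ)).const_mul c)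
    (((hright2 (2*s) (α + s)).add ((hright2 0 α).const_mul δ)).const_mul c)
    (by simpa only [sub_zero] using hmin)
  rw [← hρ] at key
  have o1 := operator_powerProfile (N:ℝ) s (b := 2*s) (β := α + s) (by ring) hρ0 hq
  have o2 := operator_powerProfile (N:ℝ) s (b := 0) (β := α) (by ring) hρ0 hq
  have hP : ∀ b β, 0 < powerProfile b β ρ q.2 := fun b β =>
    mul_pos (Real.rpow_pos_of_pos hq _) (Real.rpow_pos_of_pos hR _)
  have key2 : c * (2 * (α + s) * (2 * (α + s) - N - 2 * (2*s) + 2*s)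
        * powerProfile (2*s) (α + s + 1) ρ q.2
      + δ * (2 * α * (2 * α - N - 2 * 0 + 2*s) * powerProfile 0 (α + 1) ρ q.2)) ≤ 0 := by
    rw [← o1, ← o2]
    refine le_trans (le_of_eq ?_) key
    simp only [Pi.add_apply]
    ring
  have h1 : 0 ≤ 2 * (α + s) * (2 * (α + s) - N - 2 * (2*s) + 2*s)
      * powerProfile (2*s) (α + s + 1) ρ q.2 :=
    mul_nonneg (mul_nonneg (by positivity) (by linarith)) (hP _ _).le
  have h2 : 0 < δ * (2 * α * (2 * α - N - 2 * 0 + 2*s) * powerProfile 0 (α + 1) ρ q.2) :=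
    mul_pos hδ (mul_pos (mul_pos (by positivity) (by linarith)) (hP _ _))
  have := mul_pos hc (add_pos_of_nonneg_of_pos h1 h2)
  linarith

/-- If a solution lies above a multiple of `homBarrier` and touches it at a boundary point of
the unit sphere, its conormal derivative there is at least that of the barrier. -/
theorem conormal_ge_of_homBarrier_le {N : ℕ} {s α δ c L : ℝ} {u : Euc N × ℝ → ℝ}
    (hs : s ∈ Set.Ioo (0:ℝ) 1) (hα : 0 < α) (hδ : 0 < δ) (hc : 0 < c)
    (hcont : ContinuousOn u ({q : Euc N × ℝ | 0 ≤ q.2} \ {0}))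
    (hu : ContDiffOn ℝ 2 u {q : Euc N × ℝ | 0 < q.2})
    {x : Euc N} (hx : ‖x‖ = 1)
    (hL : Tendsto (fun z : ℝ => z ^ (1 - 2*s) * fderiv ℝ u (x, z) ((0 : Euc N), (1:ℝ)))
      (𝓝[>] (0:ℝ)) (𝓝 L))
    (hle : ∀ z, 0 < z → c * homBarrier s α δ (‖x‖^2) z ≤ u (x, z))
    (htouch : u (x, 0) = c * δ) : 2 * s * c ≤ L := by
  have hs0 := hs.1
  have hx0 : x ≠ 0 := by rintro rfl; simp at hx
  have hlim := tendsto_vertical_div_rpow hs0 hcont hu hx0 hL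
  have hlow : Tendsto (fun z : ℝ => c * ((1 + z^2) ^ (-(α + s)) - δ * α * z ^ (2 - 2*s)))
      (𝓝[>] 0) (𝓝 c) := by
    have h1 : ContinuousAt
        (fun z : ℝ => c * ((1 + z^2) ^ (-(α + s)) - δ * α * z ^ (2 - 2*s))) 0 := by
      refine ((ContinuousAt.rpow_const (by fun_prop) (Or.inl (by norm_num))).sub
        ((Real.continuousAt_rpow_const _ _ (Or.inr ?_)).const_mul _)).const_mul _
      linarith [hs.2]
    have h2 := h1.tendsto
    rw [Real.zero_rpow (by linarith [hs.2])] at h2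
    simp only [ne_eq, OfNat.ofNat_ne_zero, not_false_eq_true, zero_pow, add_zero,
      Real.one_rpow, mul_zero, sub_zero, mul_one] at h2
    exact h2.mono_left nhdsWithin_le_nhds
  have hge : c ≤ L / (2*s) := by
    refine le_of_tendsto_of_tendsto hlow hlim ?_
    filter_upwards [self_mem_nhdsWithin] with z (hz : 0 < z)
    have hp := Real.rpow_pos_of_pos hz (2*s)
    rw [le_div_iff₀ hp, htouch]
    have h1 := hle z hz
    simp only [homBarrier, powerProfile, hx, one_pow, Real.rpow_zero, one_mul] at h1
    have h2 := one_sub_mul_le_one_add_rpow_neg hα.le (sq_nonneg z)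
    have h3 : z ^ (2 - 2*s) * z ^ (2*s) = z^2 := by
      rw [← Real.rpow_add hz, ← Real.rpow_natCast]; congr 1; push_cast; ring
    have h4 : c * ((1 + z^2) ^ (-(α + s)) - δ * α * z ^ (2 - 2*s)) * z ^ (2*s)
        = c * (z ^ (2*s) * (1 + z^2) ^ (-(α + s))) - c * δ * α * z^2 := by
      rw [← h3]; ring
    rw [h4]
    have h5 := mul_le_mul_of_nonneg_left h2 (mul_pos hc hδ).le
    linarith
  rw [le_div_iff₀ (by positivity)] at hge
  linarith

theorem isCompact_upper_hemisphere (N : ℕ) :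
    IsCompact {q : Euc N × ℝ | 0 ≤ q.2 ∧ ‖q.1‖^2 + q.2^2 = 1} := by
  refine IsCompact.of_isClosed_subset ((isCompact_closedBall (0 : Euc N) 1).prod
    (isCompact_Icc (a := (0:ℝ)) (b := 1))) ?_ ?_
  · exact (isClosed_le continuous_const continuous_snd).inter
      (isClosed_eq (by fun_prop) continuous_const)
  · rintro q ⟨h1, h2⟩
    refine ⟨?_, h1, ?_⟩
    · rw [mem_closedBall, dist_zero_right]
      nlinarith [sq_nonneg q.2, norm_nonneg q.1]
    · nlinarith [sq_nonneg ‖q.1‖]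

theorem continuousOn_homBarrier {N : ℕ} {s : ℝ} (α δ : ℝ) (hs : 0 < s) :
    ContinuousOn (fun q : Euc N × ℝ => homBarrier s α δ (‖q.1‖^2) q.2)
      {q | ‖q.1‖^2 + q.2^2 ≠ 0} := by
  have h : ∀ b β : ℝ, 0 ≤ b → ContinuousOn
      (fun q : Euc N × ℝ => powerProfile b β (‖q.1‖^2) q.2) {q | ‖q.1‖^2 + q.2^2 ≠ 0} := by
    intro b β hb
    refine ContinuousOn.mul (continuous_snd.rpow_const fun _ => Or.inr hb).continuousOn ?_
    exact ContinuousOn.rpow_const (by fun_prop) fun q hq => Or.inl hq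
  exact (h (2*s) (α + s) (by positivity)).add ((h 0 α le_rfl).const_mul δ)

theorem norm_sq_add_sq_pos {N : ℕ} {q : Euc N × ℝ} (hq : q ≠ 0) : 0 < ‖q.1‖^2 + q.2^2 := by
  by_contra! h
  have h1 : ‖q.1‖^2 = 0 := by nlinarith [sq_nonneg ‖q.1‖, sq_nonneg q.2]
  have h2 : q.2^2 = 0 := by nlinarith [sq_nonneg ‖q.1‖, sq_nonneg q.2]
  exact hq (Prod.ext (norm_eq_zero.1 (pow_eq_zero_iff two_ne_zero |>.1 h1))
    (pow_eq_zero_iff two_ne_zero |>.1 h2))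

/-- A nontrivial element of `E₁⁺` is positive on the closed half-space minus the origin. -/
theorem SelfSimPos.pos {N : ℕ} {s p : ℝ} (hs : s ∈ Set.Ioo (0:ℝ) 1)
    {u : Euc N × ℝ → ℝ} (hu : u ∈ SelfSimPos N s p 1) {q₀ : Euc N × ℝ} (hq₀ : 0 ≤ q₀.2)
    (hne : q₀ ≠ 0) (huq : u q₀ ≠ 0) {q : Euc N × ℝ} (hq : 0 ≤ q.2) (hq0 : q ≠ 0) :
    0 < u q := by
  obtain ⟨⟨hcont, hC2, hhom, heq, hbc⟩, hnn⟩ := hu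
  obtain ⟨t, ht0, ht⟩ : ∃ t : ℝ, 0 < t ∧ 0 < u (q₀.1, q₀.2 + t) := by
    have h0 : 0 < u q₀ := (hnn q₀ hq₀).lt_of_ne' huq
    have h1 : Tendsto (fun t : ℝ => (q₀.1, q₀.2 + t)) (𝓝[>] 0)
        (𝓝[{q : Euc N × ℝ | 0 ≤ q.2} \ {0}] q₀) := by
      refine tendsto_nhdsWithin_iff.2 ⟨?_, ?_⟩
      · have h2 : Continuous (fun t : ℝ => (q₀.1, q₀.2 + t)) := by fun_prop
        have h3 := h2.tendsto 0
        simp only [add_zero, Prod.mk.eta] at h3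
        exact h3.mono_left nhdsWithin_le_nhds
      · filter_upwards [self_mem_nhdsWithin] with t (ht : 0 < t)
        have h2 : 0 < q₀.2 + t := by linarith
        exact ⟨h2.le, fun h => h2.ne' (congrArg Prod.snd h)⟩
    have h2 := ((hcont q₀ ⟨hq₀, hne⟩).tendsto.comp h1).eventually (lt_mem_nhds h0)
    obtain ⟨t, ht1, ht2⟩ := (h2.and self_mem_nhdsWithin).exists
    exact ⟨t, ht2, ht1⟩
  have hz : 0 < q₀.2 + t := by linarith
  have hinn : ∀ p : Euc N × ℝ, 0 < p.2 → 0 < u p := by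
    intro w hw
    set l := (q₀.2 + t) / w.2 with hl
    have hl0 : 0 < l := by positivity
    have h1 := hhom l hl0 w
    have h2 : l * w.2 = q₀.2 + t := by rw [hl]; field_simp
    rw [h2] at h1
    have h3 := pos_of_pos_at_height hs hC2 heq (fun q hq => hnn q hq.le) hz ht (l • w.1)
    rw [h1] at h3
    exact pos_of_mul_pos_right h3 (Real.rpow_nonneg hl0.le _)
  rcases hq.eq_or_lt with h | h
  · have hx : q.1 ≠ 0 := fun h1 => hq0 (Prod.ext h1 h.symm)
    have hqe : q = (q.1, 0) := Prod.ext rfl h.symm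
    refine (hnn q hq).lt_of_ne' fun hzero => ?_
    rw [hqe] at hzero
    have h1 := conormal_pos_of_boundary_zero hs hcont hC2 heq hnn hinn hx (hbc q.1 hx) hzero
    rw [hzero] at h1
    simp at h1
  · exact hinn q h

/-- Theorem A, part 2: if `1 < p ≤ 1 + 2s/N` then `E₁⁺ = {0}`. -/
theorem stmt3 (N : ℕ) (hN : 1 ≤ N) (s p : ℝ) (hs : s ∈ Set.Ioo (0:ℝ) 1)
    (hp1 : 1 < p) (hp2 : p ≤ 1 + 2*s/N)
    (u : Euc N × ℝ → ℝ) (hu : u ∈ SelfSimPos N s p 1) :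
    ∀ q : Euc N × ℝ, 0 ≤ q.2 → q ≠ 0 → u q = 0 := by
  intro q hq hq0
  by_contra hne
  have hpos : ∀ w : Euc N × ℝ, 0 ≤ w.2 → w ≠ 0 → 0 < u w := fun w hw hw0 =>
    SelfSimPos.pos hs hu hq hq0 hne hw hw0
  obtain ⟨⟨hcont, hC2, hhom, heq, hbc⟩, hnn⟩ := hu
  have hs0 := hs.1
  have hp0 : 0 < p - 1 := by linarith
  have hN0 : (0:ℝ) < N := by exact_mod_cast hN
  set α := s / (p - 1) with hα
  have hα0 : 0 < α := by positivity
  have hNα : (N:ℝ) ≤ 2 * α := by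
    have h1 : p - 1 ≤ 2*s/N := by linarith
    rw [le_div_iff₀ hN0] at h1
    rw [hα, ← mul_div_assoc, le_div_iff₀ hp0]
    linarith
  have hexp : -(2*s)/(p-1) = -(2*α) := by rw [hα]; ring
  have he0 : ((0 : Euc N), (1:ℝ)) ≠ 0 := fun h => one_ne_zero (congrArg Prod.snd h)
  set M := u ((0 : Euc N), (1:ℝ)) with hM
  have hM0 : 0 < M := hpos _ zero_le_one he0
  have hMp : 0 < M ^ (p - 1) := Real.rpow_pos_of_pos hM0 _
  set δ := min 1 (s / M ^ (p - 1)) with hδ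
  have hδ0 : 0 < δ := lt_min one_pos (by positivity)
  have hδ1 : δ ≤ 1 := min_le_left _ _
  have hδM : δ * M ^ (p - 1) ≤ s := by
    rw [← le_div_iff₀ hMp]; exact min_le_right _ _
  set Φ : Euc N × ℝ → ℝ := fun w => homBarrier s α δ (‖w.1‖^2) w.2 with hΦ
  have hS := isCompact_upper_hemisphere N
  have hSne : ∀ w : Euc N × ℝ, ‖w.1‖^2 + w.2^2 = 1 → w ≠ 0 := by
    rintro w hw rfl
    simp at hw
  have hΦpos : ∀ w ∈ {q : Euc N × ℝ | 0 ≤ q.2 ∧ ‖q.1‖^2 + q.2^2 = 1}, 0 < Φ w := fun w hw =>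
    homBarrier_pos hδ0 hw.1 (by rw [hw.2]; exact one_pos)
  obtain ⟨w, hwS, hwmin⟩ := hS.exists_isMinOn ⟨((0 : Euc N), (1:ℝ)), by simp⟩
    ((hcont.mono fun w hw => ⟨hw.1, hSne w hw.2⟩).div
      ((continuousOn_homBarrier α δ hs0).mono fun w hw => by simp [hw.2])
      fun w hw => (hΦpos w hw).ne')
  have hw0 := hSne w hwS.2
  set c := u w / Φ w with hc
  have hc0 : 0 < c := div_pos (hpos w hwS.1 hw0) (hΦpos w hwS)
  have hcw : u w = c * Φ w := by rw [hc, div_mul_cancel₀ _ (hΦpos w hwS).ne']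
  have hle : ∀ v : Euc N × ℝ, 0 ≤ v.2 → v ≠ 0 → c * Φ v ≤ u v := by
    intro v hv hv0
    have hR := norm_sq_add_sq_pos hv0
    set l := (√(‖v.1‖^2 + v.2^2))⁻¹ with hl
    have hl0 : 0 < l := by positivity
    have hl2 : l^2 * (‖v.1‖^2 + v.2^2) = 1 := by
      rw [hl, inv_pow, Real.sq_sqrt hR.le, inv_mul_cancel₀ hR.ne']
    have hn : ‖l • v.1‖^2 = l^2 * ‖v.1‖^2 := by
      rw [norm_smul, Real.norm_of_nonneg hl0.le, mul_pow]
    have hmem : (l • v.1, l * v.2) ∈ {q : Euc N × ℝ | 0 ≤ q.2 ∧ ‖q.1‖^2 + q.2^2 = 1} := by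
      refine ⟨mul_nonneg hl0.le hv, ?_⟩
      simp only [hn]
      rw [← hl2]; ring
    have h1 : c ≤ u (l • v.1, l * v.2) / Φ (l • v.1, l * v.2) := hwmin hmem
    rw [le_div_iff₀ (hΦpos _ hmem), hhom l hl0, hexp] at h1
    simp only [hΦ, hn] at h1
    rw [homBarrier_scale s α δ hl0 (by positivity) hv] at h1
    have h2 : 0 < l ^ (-(2*α)) := Real.rpow_pos_of_pos hl0 _
    refine le_of_mul_le_mul_left ?_ h2
    linarith
  rcases hwS.1.eq_or_lt with h | h
  · have hwe : w = (w.1, 0) := Prod.ext rfl h.symm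
    have hx1 : ‖w.1‖ = 1 := by
      have := hwS.2
      rw [← h] at this
      nlinarith [norm_nonneg w.1]
    have hx0 : w.1 ≠ 0 := by
      intro h0; rw [h0, norm_zero] at hx1; exact zero_ne_one hx1
    have htouch : u (w.1, 0) = c * δ := by
      rw [← hwe, hcw]
      simp only [hΦ, homBarrier, powerProfile, hx1, ← h]
      rw [Real.zero_rpow (by positivity)]
      simp
    have h1 := conormal_ge_of_homBarrier_le hs hα0 hδ0 hc0 hcont hC2 hx1 (hbc w.1 hx0)
      (fun z hz => hle (w.1, z) hz.le fun h0 => hx0 (congrArg Prod.fst h0)) htouch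
    rw [htouch, abs_of_pos (by positivity), one_mul] at h1
    have hcM : c ≤ M := by
      have h2 := hle ((0 : Euc N), (1:ℝ)) zero_le_one he0
      simp only [hΦ, homBarrier, powerProfile] at h2
      simp at h2
      nlinarith
    have h2 : (c * δ) ^ (p - 1) ≤ M ^ (p - 1) :=
      Real.rpow_le_rpow (by positivity) (by nlinarith) hp0.le
    have h3 : (c * δ) ^ (p - 1) * (c * δ) ≤ c * s := by
      calc (c * δ) ^ (p - 1) * (c * δ) ≤ M ^ (p - 1) * (c * δ) :=
            mul_le_mul_of_nonneg_right h2 (by positivity)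
        _ = c * (δ * M ^ (p - 1)) := by ring
        _ ≤ c * s := mul_le_mul_of_nonneg_left hδM hc0.le
    nlinarith
  · refine not_isLocalMin_sub_homBarrier hs0 hα0 hNα hδ0 hc0 hC2 h (heq w h) ?_
    filter_upwards [(isOpen_lt continuous_const continuous_snd).mem_nhds h] with v hv
    have h1 := hle v (le_of_lt hv) fun h0 => (ne_of_gt hv) (congrArg Prod.snd h0)
    simp only [hΦ] at h1 hcw
    linarith
end

section
/- Let N ≥ 1 be an integer, s ∈ (0,1) with N > 2s, and 1 + 2s/N < p < N/(N-2s). Then E_1^+ = {0, u₁}: there exists u₁ ∈ E_1^+ which is strictly positive on cl(ℝ^{N+1}_+)∖{0} and invariant under rotations of the x-variable (u₁(x,z) depends only on |x| and z), and every nonnegative element of E_1^+ is either identically 0 or equal to u₁. -/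
open MeasureTheory Filter Topology Set Metric Asymptotics

section Calculus

variable {N : ℕ} {u : Euc N × ℝ → ℝ} {q v : Euc N × ℝ}

lemma hasDerivAt_line (q v : Euc N × ℝ) (t : ℝ) :
    HasDerivAt (fun t : ℝ => q + t • v) v t := by
  simpa using ((hasDerivAt_id t).smul_const v).const_add q

lemma eventually_contDiffAt_line (hu : ContDiffAt ℝ 2 u q) (v : Euc N × ℝ) :
    ∀ᶠ t : ℝ in 𝓝 0, ContDiffAt ℝ 2 u (q + t • v) := by
  have hc : ContinuousAt (fun t : ℝ => q + t • v) 0 := (hasDerivAt_line q v 0).continuousAt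
  have h := hu.eventually (by simp)
  exact hc.eventually (by simpa using h)

lemma hasDerivAt_comp_line (hu : ContDiffAt ℝ 2 u q) (v : Euc N × ℝ) :
    ∀ᶠ t : ℝ in 𝓝 0,
      HasDerivAt (fun t : ℝ => u (q + t • v)) (fderiv ℝ u (q + t • v) v) t := by
  filter_upwards [eventually_contDiffAt_line hu v] with t ht
  exact (ht.differentiableAt (by simp)).hasFDerivAt.comp_hasDerivAt t (hasDerivAt_line q v t)

lemma differentiableAt_fderiv_apply (hu : ContDiffAt ℝ 2 u q) (v : Euc N × ℝ) :
    DifferentiableAt ℝ (fun w => fderiv ℝ u w v) q := by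
  have h : ContDiffAt ℝ 1 (fderiv ℝ u) q := hu.fderiv_right (by norm_num)
  exact (h.differentiableAt (by simp)).clm_apply (differentiableAt_const v)

lemma hasDerivAt_fderiv_line (hu : ContDiffAt ℝ 2 u q) (v : Euc N × ℝ) :
    HasDerivAt (fun t : ℝ => fderiv ℝ u (q + t • v) v) (d2 u q v) 0 := by
  have h := (differentiableAt_fderiv_apply hu v).hasFDerivAt
  have h' : HasFDerivAt (fun w => fderiv ℝ u w v) (fderiv ℝ (fun w => fderiv ℝ u w v) q)
      (q + (0 : ℝ) • v) := by simpa using h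
  exact h'.comp_hasDerivAt (0 : ℝ) (hasDerivAt_line q v 0)

lemma fderiv_eq_of_line (hu : DifferentiableAt ℝ u q) {φ' : ℝ}
    (h : HasDerivAt (fun t : ℝ => u (q + t • v)) φ' 0) : fderiv ℝ u q v = φ' := by
  have h' : HasFDerivAt u (fderiv ℝ u q) (q + (0 : ℝ) • v) := by simpa using hu.hasFDerivAt
  exact (h'.comp_hasDerivAt (0 : ℝ) (hasDerivAt_line q v 0)).unique h

lemma d2_eq_of_line (hu : ContDiffAt ℝ 2 u q) {φ₁ : ℝ → ℝ} {φ₂ : ℝ}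
    (h₁ : ∀ᶠ t : ℝ in 𝓝 0, HasDerivAt (fun t : ℝ => u (q + t • v)) (φ₁ t) t)
    (h₂ : HasDerivAt φ₁ φ₂ 0) : d2 u q v = φ₂ := by
  refine (hasDerivAt_fderiv_line hu v).unique (h₂.congr_of_eventuallyEq ?_)
  filter_upwards [h₁, hasDerivAt_comp_line hu v] with t h1 h2
  exact h2.unique h1

lemma d2_nonneg_of_isLocalMin (hu : ContDiffAt ℝ 2 u q) (hm : IsLocalMin u q)
    (v : Euc N × ℝ) : 0 ≤ d2 u q v := by
  by_contra! hneg
  set φ : ℝ → ℝ := fun t => u (q + t • v) with hφ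
  have hc : ContinuousAt (fun t : ℝ => q + t • v) 0 := (hasDerivAt_line q v 0).continuousAt
  have hmin : IsLocalMin φ 0 := by
    have : ∀ᶠ w in 𝓝 (q + (0 : ℝ) • v), u q ≤ u w := by
      rw [zero_smul, add_zero]; exact hm
    filter_upwards [hc.eventually this] with t ht
    simpa [hφ] using ht
  have hd : deriv φ =ᶠ[𝓝 0] fun t => fderiv ℝ u (q + t • v) v := by
    filter_upwards [hasDerivAt_comp_line hu v] with t ht using ht.deriv
  have hdd : deriv (deriv φ) 0 = d2 u q v := by
    rw [hd.deriv_eq, (hasDerivAt_fderiv_line hu v).deriv]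
  have hmax : IsLocalMax φ 0 := isLocalMax_of_deriv_deriv_neg (by rw [hdd]; exact hneg)
    hmin.deriv_eq_zero (hasDerivAt_comp_line hu v).self_of_nhds.continuousAt
  have hconst : φ =ᶠ[𝓝 0] fun _ => φ 0 := by
    filter_upwards [hmin, hmax] with t h1 h2 using le_antisymm h2 h1
  have : deriv (deriv φ) 0 = 0 := by
    rw [hconst.deriv.deriv_eq]; simp
  linarith [hdd ▸ this]

lemma CSop_nonneg_of_isLocalMin (s : ℝ) (hu : ContDiffAt ℝ 2 u q) (hq : 0 < q.2)
    (hm : IsLocalMin u q) : 0 ≤ CSop N s u q := by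
  have h0 : fderiv ℝ u q = 0 := hm.fderiv_eq_zero
  simp only [CSop, h0, _root_.zero_apply, mul_zero, add_zero]
  exact mul_nonneg (Real.rpow_nonneg hq.le _)
    (add_nonneg (Finset.sum_nonneg fun i _ => d2_nonneg_of_isLocalMin hu hm _)
      (d2_nonneg_of_isLocalMin hu hm _))

lemma CSop_linear_comb (s a b : ℝ) {f g : Euc N × ℝ → ℝ} (hf : ContDiffAt ℝ 2 f q)
    (hg : ContDiffAt ℝ 2 g q) :
    CSop N s (fun w => a * f w + b * g w) q = a * CSop N s f q + b * CSop N s g q := by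
  have hF : ContDiffAt ℝ 2 (fun w => a * f w + b * g w) q :=
    (contDiffAt_const.mul hf).add (contDiffAt_const.mul hg)
  have hd2 : ∀ v, d2 (fun w => a * f w + b * g w) q v = a * d2 f q v + b * d2 g q v := by
    intro v
    refine d2_eq_of_line hF (φ₁ := fun t => a * fderiv ℝ f (q + t • v) v +
      b * fderiv ℝ g (q + t • v) v) ?_
      (((hasDerivAt_fderiv_line hf v).const_mul a).add
        ((hasDerivAt_fderiv_line hg v).const_mul b))
    filter_upwards [hasDerivAt_comp_line hf v, hasDerivAt_comp_line hg v] with t h1 h2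
    exact (h1.const_mul a).add (h2.const_mul b)
  have hd1 : ∀ v, fderiv ℝ (fun w => a * f w + b * g w) q v
      = a * fderiv ℝ f q v + b * fderiv ℝ g q v := by
    intro v
    refine fderiv_eq_of_line (hF.differentiableAt (by simp)) ?_
    have h1 := (hasDerivAt_comp_line hf v).self_of_nhds
    have h2 := (hasDerivAt_comp_line hg v).self_of_nhds
    exact ((h1.const_mul a).add (h2.const_mul b)).congr_deriv (by simp)
  simp only [CSop, hd2, hd1, Finset.sum_add_distrib, ← Finset.mul_sum]
  ring

lemma norm_sq_add_single_sub (x c : Euc N) (i : Fin N) (t : ℝ) :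
    ‖x + t • EuclideanSpace.single i (1 : ℝ) - c‖ ^ 2
      = ‖x - c‖ ^ 2 + 2 * t * (x - c) i + t ^ 2 := by
  have : x + t • EuclideanSpace.single i (1 : ℝ) - c
      = (x - c) + t • EuclideanSpace.single i (1 : ℝ) := by abel
  rw [this, norm_add_sq_real, inner_smul_right, norm_smul, EuclideanSpace.inner_single_right]
  simp
  ring

/-- The operator in the variables `(‖x - c‖², z)`. -/
lemma CSop_eq_of_radial (s : ℝ) {x : Euc N} {z : ℝ} (hu : ContDiffAt ℝ 2 u (x, z)) (c : Euc N)
    {g g₁ h₁ : ℝ → ℝ} {g₂ h₂ : ℝ} (hg : ∀ x', u (x', z) = g (‖x' - c‖ ^ 2))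
    (hg₁ : ∀ᶠ r in 𝓝 (‖x - c‖ ^ 2), HasDerivAt g (g₁ r) r)
    (hg₂ : HasDerivAt g₁ g₂ (‖x - c‖ ^ 2))
    (hh₁ : ∀ᶠ w in 𝓝 z, HasDerivAt (fun w => u (x, w)) (h₁ w) w)
    (hh₂ : HasDerivAt h₁ h₂ z) :
    CSop N s u (x, z) = z ^ (1 - 2 * s) *
        (4 * ‖x - c‖ ^ 2 * g₂ + 2 * N * g₁ (‖x - c‖ ^ 2) + h₂)
      + (1 - 2 * s) * z ^ (-(2 * s)) * h₁ z := by
  have hx : ∀ i : Fin N, d2 u (x, z) (EuclideanSpace.single i (1 : ℝ), (0 : ℝ))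
      = 4 * ((x - c) i) ^ 2 * g₂ + 2 * g₁ (‖x - c‖ ^ 2) := by
    intro i
    set k : ℝ → ℝ := fun t => ‖x - c‖ ^ 2 + 2 * t * (x - c) i + t ^ 2 with hk
    have hkd : ∀ t, HasDerivAt k (2 * (x - c) i + 2 * t) t := by
      intro t
      have h := ((((hasDerivAt_id t).const_mul 2).mul_const ((x - c) i)).const_add
        (‖x - c‖ ^ 2)).add ((hasDerivAt_id t).pow 2)
      exact h.congr_deriv (by simp)
    have hk0 : k 0 = ‖x - c‖ ^ 2 := by simp [hk]
    have hline : (fun t : ℝ => u ((x, z) + t • (EuclideanSpace.single i (1 : ℝ), (0 : ℝ))))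
        = fun t => g (k t) := by
      funext t
      have h1 : (x, z) + t • ((EuclideanSpace.single i (1 : ℝ) : Euc N), (0 : ℝ))
          = (x + t • EuclideanSpace.single i (1 : ℝ), z) := by ext <;> simp
      rw [h1, hg, norm_sq_add_single_sub]
    refine d2_eq_of_line hu (φ₁ := fun t => g₁ (k t) * (2 * (x - c) i + 2 * t)) ?_ ?_
    · rw [hline]
      have : ∀ᶠ t in 𝓝 (0 : ℝ), HasDerivAt g (g₁ (k t)) (k t) := by
        have hc := (hkd 0).continuousAt
        rw [ContinuousAt, hk0] at hc
        exact hc.eventually hg₁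
      filter_upwards [this] with t ht using ht.comp t (hkd t)
    · have h1 : HasDerivAt (fun t => g₁ (k t)) (g₂ * (2 * (x - c) i + 2 * 0)) 0 :=
        HasDerivAt.comp (0 : ℝ) (by rw [hk0]; exact hg₂) (hkd 0)
      have h2 : HasDerivAt (fun t : ℝ => 2 * (x - c) i + 2 * t) 2 0 := by
        simpa using ((hasDerivAt_id (0 : ℝ)).const_mul 2).const_add (2 * (x - c) i)
      refine (h1.mul h2).congr_deriv ?_
      rw [hk0]; ring
  have hline : ∀ t : ℝ, (x, z) + t • ((0 : Euc N), (1 : ℝ)) = (x, z + t) := by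
    intro t; ext <;> simp
  have hshift : ∀ t, HasDerivAt (fun t => z + t) 1 t := fun t => (hasDerivAt_id t).const_add z
  have hz1 : ∀ᶠ t : ℝ in 𝓝 0, HasDerivAt
      (fun t : ℝ => u ((x, z) + t • ((0 : Euc N), (1 : ℝ)))) (h₁ (z + t)) t := by
    have hc : Tendsto (fun t => z + t) (𝓝 0) (𝓝 z) := by
      simpa using (hshift 0).continuousAt.tendsto
    filter_upwards [hc.eventually hh₁] with t ht
    simp only [hline]
    exact (HasDerivAt.comp t ht (hshift t)).congr_deriv (mul_one _)
  have hz2 : HasDerivAt (fun t => h₁ (z + t)) h₂ 0 := by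
    have : HasDerivAt h₁ h₂ (z + 0) := by simpa using hh₂
    exact (HasDerivAt.comp (0 : ℝ) this (hshift 0)).congr_deriv (mul_one _)
  have hd2z := d2_eq_of_line hu hz1 hz2
  have hd1z := fderiv_eq_of_line (hu.differentiableAt (by simp)) hz1.self_of_nhds
  rw [add_zero] at hd1z
  have hsum : ‖x - c‖ ^ 2 = ∑ i, ((x - c) i) ^ 2 := by
    rw [EuclideanSpace.norm_sq_eq]; simp
  simp only [CSop, hx, hd2z, hd1z, Finset.sum_add_distrib, ← Finset.sum_mul, ← Finset.mul_sum]
  rw [← hsum, Finset.sum_const, Finset.card_univ, Fintype.card_fin, nsmul_eq_mul]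
  ring

end Calculus

section MaximumPrinciple

variable {N : ℕ} {s : ℝ} {u : Euc N × ℝ → ℝ}

lemma nonneg_of_CSop_neg {K : Set (Euc N × ℝ)} (hK : IsCompact K) {v : Euc N × ℝ → ℝ}
    (hv : ContinuousOn v K)
    (h : ∀ q ∈ K, 0 ≤ v q ∨ (K ∈ 𝓝 q ∧ 0 < q.2 ∧ ContDiffAt ℝ 2 v q ∧ CSop N s v q < 0)) :
    ∀ q ∈ K, 0 ≤ v q := by
  intro q hq
  obtain ⟨q₀, hq₀, hmin⟩ := hK.exists_isMinOn ⟨q, hq⟩ hv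
  rcases h q₀ hq₀ with h0 | ⟨hnhds, hpos, hc, hneg⟩
  · exact h0.trans (hmin hq)
  · exact absurd (CSop_nonneg_of_isLocalMin s hc hpos (hmin.isLocalMin hnhds)) (not_le.2 hneg)

lemma contDiff_norm_sub_sq (c : Euc N) :
    ContDiff ℝ 2 (fun q : Euc N × ℝ => ‖q.1 - c‖ ^ 2) :=
  (contDiff_fst.sub contDiff_const).norm_sq ℝ

lemma rpow_neg_two_mul {z : ℝ} (hz : 0 < z) (s : ℝ) :
    z ^ (-(2 * s)) = z ^ (1 - 2 * s) / z := by
  rw [show -(2 * s) = (1 - 2 * s) - 1 by ring, Real.rpow_sub_one hz.ne']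

lemma CSop_gaussian (s m : ℝ) (c x : Euc N) (d : ℝ) {z : ℝ} (hz : 0 < z) :
    CSop N s (fun q => Real.exp (-m * (‖q.1 - c‖ ^ 2 + (q.2 - d) ^ 2))) (x, z)
      = z ^ (1 - 2 * s) * Real.exp (-m * (‖x - c‖ ^ 2 + (z - d) ^ 2)) * (2 * m) *
        (2 * m * (‖x - c‖ ^ 2 + (z - d) ^ 2) - (N + 1) - (1 - 2 * s) * ((z - d) / z)) := by
  have hu : ContDiff ℝ 2 (fun q : Euc N × ℝ =>
      Real.exp (-m * (‖q.1 - c‖ ^ 2 + (q.2 - d) ^ 2))) :=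
    (contDiff_const.mul ((contDiff_norm_sub_sq c).add
      ((contDiff_snd.sub contDiff_const).pow 2))).exp
  have hg : ∀ r : ℝ, HasDerivAt (fun r => Real.exp (-m * (r + (z - d) ^ 2)))
      (Real.exp (-m * (r + (z - d) ^ 2)) * (-m)) r := fun r => by
    simpa using (((hasDerivAt_id r).add_const ((z - d) ^ 2)).const_mul (-m)).exp
  have hh : ∀ w : ℝ, HasDerivAt (fun w => Real.exp (-m * (‖x - c‖ ^ 2 + (w - d) ^ 2)))
      (Real.exp (-m * (‖x - c‖ ^ 2 + (w - d) ^ 2)) * (-m * (2 * (w - d)))) w := fun w => by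
    simpa using ((((hasDerivAt_id w).sub_const d).pow 2).const_add (‖x - c‖ ^ 2)
      |>.const_mul (-m)).exp
  have hh' : HasDerivAt (fun w : ℝ => -m * (2 * (w - d))) (-m * 2) z := by
    simpa using (((hasDerivAt_id z).sub_const d).const_mul 2).const_mul (-m)
  rw [CSop_eq_of_radial s hu.contDiffAt c (fun _ => rfl) (Eventually.of_forall hg)
    ((hg _).mul_const (-m)) (Eventually.of_forall hh) ((hh z).mul hh'), rpow_neg_two_mul hz]
  field_simp
  ring

/-- Quantitative interior spreading of positivity. -/
lemma pos_of_pos_nearby (hs : s ∈ Ioo (0 : ℝ) 1) (hu : ContDiffOn ℝ 2 u {q | 0 < q.2})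
    (h0 : ∀ q : Euc N × ℝ, 0 < q.2 → 0 ≤ u q)
    (hL : ∀ q : Euc N × ℝ, 0 < q.2 → CSop N s u q = 0)
    {c x : Euc N} {d z : ℝ} (hd : 0 < d) (hc : 0 < u (c, d))
    (hxz : ‖x - c‖ ^ 2 + (z - d) ^ 2 < (d / 2) ^ 2) : 0 < u (x, z) := by
  have hopen : IsOpen {q : Euc N × ℝ | 0 < q.2} := isOpen_lt continuous_const continuous_snd
  have huat : ∀ q : Euc N × ℝ, 0 < q.2 → ContDiffAt ℝ 2 u q := fun q hq =>
    hu.contDiffAt (hopen.mem_nhds hq)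
  set Q : Euc N × ℝ → ℝ := fun q => ‖q.1 - c‖ ^ 2 + (q.2 - d) ^ 2 with hQ
  have hQc : Continuous Q := by fun_prop
  have hQz : ∀ q, Q q ≤ (d / 2) ^ 2 → d / 2 ≤ q.2 := by
    intro q hq
    have h1 : (q.2 - d) ^ 2 ≤ (d / 2) ^ 2 := by
      have := sq_nonneg ‖q.1 - c‖
      simp only [hQ] at hq; linarith
    have := (abs_le.1 (abs_le_of_sq_le_sq h1 (by linarith))).1
    linarith
  set η := u (c, d) / 2 with hη
  have hηpos : 0 < η := by positivity
  obtain ⟨ε, hε, hball⟩ := Metric.eventually_nhds_iff.1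
    ((huat (c, d) hd).continuousAt.eventually (lt_mem_nhds (show η < u (c, d) by linarith)))
  set ρ := ε / 2 with hρ
  have hρpos : 0 < ρ := by positivity
  have hnear : ∀ q, Q q ≤ ρ ^ 2 → η < u q := by
    intro q hq
    refine hball ?_
    have h1 : ‖q.1 - c‖ ≤ ρ := by
      refine abs_le_of_sq_le_sq' ?_ hρpos.le |>.2
      have := sq_nonneg (q.2 - d)
      simp only [hQ] at hq; linarith
    have h2 : |q.2 - d| ≤ ρ := by
      refine abs_le_of_sq_le_sq ?_ hρpos.le
      have := sq_nonneg ‖q.1 - c‖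
      simp only [hQ] at hq; linarith
    rw [Prod.dist_eq, dist_eq_norm, Real.dist_eq]
    exact (max_le h1 h2).trans_lt (by linarith)
  rcases le_or_gt (Q (x, z)) (ρ ^ 2) with hle | hgt
  · exact hηpos.trans (hnear _ hle)
  set m : ℝ := (N + 3) / ρ ^ 2 with hm
  have hmpos : 0 < m := by positivity
  set K : Set (Euc N × ℝ) := {q | ρ ^ 2 ≤ Q q ∧ Q q ≤ (d / 2) ^ 2} with hKdef
  have hKcl : IsClosed K :=
    (isClosed_le continuous_const hQc).inter (isClosed_le hQc continuous_const)
  have hK : IsCompact K := by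
    refine (isCompact_closedBall (c, d) (d / 2)).of_isClosed_subset hKcl ?_
    intro q hq
    have h1 : ‖q.1 - c‖ ≤ d / 2 := by
      refine abs_le_of_sq_le_sq' ?_ (by linarith) |>.2
      have := sq_nonneg (q.2 - d)
      have := hq.2
      simp only [hQ] at this; linarith
    have h2 : |q.2 - d| ≤ d / 2 := by
      refine abs_le_of_sq_le_sq ?_ (by linarith)
      have := sq_nonneg ‖q.1 - c‖
      have := hq.2
      simp only [hQ] at this; linarith
    rw [mem_closedBall, Prod.dist_eq, dist_eq_norm, Real.dist_eq]
    exact max_le h1 h2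
  set E : Euc N × ℝ → ℝ := fun q => Real.exp (-m * (‖q.1 - c‖ ^ 2 + (q.2 - d) ^ 2)) with hE
  have hEs : ContDiff ℝ 2 E :=
    (contDiff_const.mul ((contDiff_norm_sub_sq c).add
      ((contDiff_snd.sub contDiff_const).pow 2))).exp
  set e₀ := Real.exp (-m * (d / 2) ^ 2) with he₀
  have hEge : ∀ q, ρ ^ 2 ≤ Q q → Q q ≤ (d / 2) ^ 2 → 0 < q.2 → 0 < CSop N s E q := by
    rintro ⟨y, w⟩ h1 h2 hw
    have hdw := hQz _ h2
    simp only at hdw hw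
    rw [hE, CSop_gaussian s m c y d hw]
    have hmQ : (N + 3 : ℝ) ≤ m * Q (y, w) := by
      calc (N + 3 : ℝ) = m * ρ ^ 2 := by rw [hm]; field_simp
        _ ≤ _ := by gcongr
    have hfrac : |(1 - 2 * s) * ((w - d) / w)| ≤ 1 := by
      rw [abs_mul]
      refine mul_le_one₀ (abs_le.2 ⟨by linarith [hs.2], by linarith [hs.1]⟩) (abs_nonneg _) ?_
      rw [abs_div, abs_of_pos hw, div_le_one hw, abs_le]
      constructor <;> linarith
    have := (abs_le.1 hfrac).2
    have hN : (0 : ℝ) ≤ N := Nat.cast_nonneg N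
    simp only [hQ] at hmQ
    refine mul_pos (by positivity) ?_
    nlinarith
  have key := nonneg_of_CSop_neg (s := s) hK
    (v := fun q => 1 * u q + (-η) * (E q - e₀)) ?_ ?_ (x, z) ⟨hgt.le, hxz.le⟩
  · have : e₀ < E (x, z) := by
      rw [he₀, hE, Real.exp_lt_exp]
      nlinarith
    nlinarith
  · refine (continuousOn_const.mul (hu.continuousOn.mono fun q hq => ?_)).add
      (continuousOn_const.mul (hEs.continuous.continuousOn.sub continuousOn_const))
    have := hQz q hq.2
    exact lt_of_lt_of_le (by linarith) this
  · intro q hq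
    have hq2 : 0 < q.2 := lt_of_lt_of_le (by linarith) (hQz q hq.2)
    have hE1 : E q ≤ 1 := by
      rw [hE, Real.exp_le_one_iff]
      have : 0 ≤ Q q := by positivity
      simp only [hQ] at this
      nlinarith
    have he0 : 0 < e₀ := Real.exp_pos _
    rcases eq_or_lt_of_le hq.1 with h1 | h1
    · left
      have := hnear q h1.ge
      nlinarith
    rcases eq_or_lt_of_le hq.2 with h2 | h2
    · left
      have : E q = e₀ := by
        rw [he₀, hE, ← h2]
      rw [this]
      have := h0 q hq2
      linarith
    right
    have hEat : ContDiffAt ℝ 2 (fun q => E q - e₀) q := (hEs.sub contDiff_const).contDiffAt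
    refine ⟨?_, hq2, (contDiffAt_const.mul (huat q hq2)).add (contDiffAt_const.mul hEat), ?_⟩
    · filter_upwards [hQc.continuousAt.eventually (lt_mem_nhds h1),
        hQc.continuousAt.eventually (gt_mem_nhds h2)] with w h3 h4 using ⟨h3.le, h4.le⟩
    · rw [CSop_linear_comb s _ _ (huat q hq2) hEat, hL q hq2]
      have h1E := CSop_linear_comb (q := q) s 1 (-e₀) hEs.contDiffAt
        (contDiffAt_const (c := (1 : ℝ)))
      have hconst : CSop N s (fun _ => (1 : ℝ)) q = 0 := by
        simp [CSop, d2]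
      have hfun : (fun q => E q - e₀) = fun w => 1 * E w + -e₀ * 1 := by
        funext w; ring
      rw [hfun, h1E, hconst]
      have := hEge q hq.1 hq.2 hq2
      nlinarith

/-- Strong minimum principle in the open half-space. -/
lemma pos_of_exists_pos (hs : s ∈ Ioo (0 : ℝ) 1) (hu : ContDiffOn ℝ 2 u {q | 0 < q.2})
    (h0 : ∀ q : Euc N × ℝ, 0 < q.2 → 0 ≤ u q)
    (hL : ∀ q : Euc N × ℝ, 0 < q.2 → CSop N s u q = 0)
    (hex : ∃ q : Euc N × ℝ, 0 < q.2 ∧ 0 < u q) (q : Euc N × ℝ) (hq : 0 < q.2) : 0 < u q := by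
  have hopen : IsOpen {q : Euc N × ℝ | 0 < q.2} := isOpen_lt continuous_const continuous_snd
  have hconv : Convex ℝ {q : Euc N × ℝ | 0 < q.2} :=
    convex_halfSpace_gt (f := fun q : Euc N × ℝ => q.2) ⟨fun _ _ => rfl, fun _ _ => rfl⟩ 0
  set P : Set (Euc N × ℝ) := {q | 0 < q.2} ∩ u ⁻¹' Ioi 0 with hP
  have hPo : IsOpen P := hu.continuousOn.isOpen_inter_preimage hopen isOpen_Ioi
  obtain ⟨q₀, hq₀, hq₀'⟩ := hex
  refine (hconv.isPreconnected.subset_of_closure_inter_subset hPo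
    ⟨q₀, hq₀, hq₀, hq₀'⟩ ?_ hq).2
  rintro ⟨x, z⟩ ⟨hcl, hz⟩
  refine ⟨hz, ?_⟩
  change 0 < z at hz
  obtain ⟨⟨c, d⟩, ⟨hd, hcd⟩, hdist⟩ := Metric.mem_closure_iff.1 hcl (z / 8) (by positivity)
  rw [Prod.dist_eq, max_lt_iff, dist_eq_norm, Real.dist_eq] at hdist
  obtain ⟨h1, h2⟩ := hdist
  simp only at h1 h2 hd
  have h3 := abs_lt.1 h2
  refine pos_of_pos_nearby hs hu h0 hL hd hcd ?_
  have h4 : ‖x - c‖ ^ 2 ≤ (z / 8) ^ 2 := by gcongr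
  have h5 : (z - d) ^ 2 ≤ (z / 8) ^ 2 := sq_le_sq' (by linarith) (by linarith)
  have h6 : (z * (7 / 16)) ^ 2 ≤ (d / 2) ^ 2 := by
    gcongr; linarith
  nlinarith

lemma eventually_lt_of_weighted_deriv_neg {w w' : ℝ → ℝ} {l : ℝ} (hl : l < 0)
    (hc : ContinuousOn w (Ici 0)) (hd : ∀ z, 0 < z → HasDerivAt w (w' z) z)
    (ht : Tendsto (fun z : ℝ => z ^ (1 - 2 * s) * w' z) (𝓝[>] 0) (𝓝 l)) :
    ∀ᶠ z in 𝓝[>] (0 : ℝ), w z < w 0 := by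
  obtain ⟨δ, hδ, hsub⟩ := mem_nhdsGT_iff_exists_Ioo_subset.1 (ht.eventually (gt_mem_nhds hl))
  have hδ : 0 < δ := hδ
  have hanti : StrictAntiOn w (Ico 0 δ) := by
    refine strictAntiOn_of_deriv_neg (convex_Ico 0 δ) (hc.mono fun z hz => hz.1) ?_
    intro z hz
    rw [interior_Ico] at hz
    rw [(hd z hz.1).deriv]
    have h1 : z ^ (1 - 2 * s) * w' z < 0 := hsub hz
    have h2 : 0 < z ^ (1 - 2 * s) := Real.rpow_pos_of_pos hz.1 _
    by_contra! h3
    exact absurd h1 (not_lt.2 (mul_nonneg h2.le h3))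
  filter_upwards [Ioo_mem_nhdsGT hδ] with z hz
  exact hanti ⟨le_rfl, hδ⟩ ⟨hz.1.le, hz.2⟩ hz.1

lemma hasDerivAt_vertical {x : Euc N} {z : ℝ} (hu : DifferentiableAt ℝ u (x, z)) :
    HasDerivAt (fun w => u (x, w)) (fderiv ℝ u (x, z) ((0 : Euc N), (1 : ℝ))) z :=
  hu.hasFDerivAt.comp_hasDerivAt z ((hasDerivAt_const z x).prodMk (hasDerivAt_id z))

end MaximumPrinciple

section Comparison

variable {N : ℕ} {s p : ℝ} {u : Euc N × ℝ → ℝ}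

lemma isOpen_upper : IsOpen {q : Euc N × ℝ | 0 < q.2} :=
  isOpen_lt continuous_const continuous_snd

lemma contDiffAt_of_upper (hu : ContDiffOn ℝ 2 u {q | 0 < q.2}) {q : Euc N × ℝ}
    (hq : 0 < q.2) : ContDiffAt ℝ 2 u q :=
  hu.contDiffAt (isOpen_upper.mem_nhds hq)

lemma continuousOn_vertical (hu : ContinuousOn u ({q : Euc N × ℝ | 0 ≤ q.2} \ {0})) {x : Euc N}
    (hx : x ≠ 0) : ContinuousOn (fun z : ℝ => u (x, z)) (Ici 0) := by
  refine hu.comp (f := fun z : ℝ => (x, z)) (by fun_prop) fun z hz => ⟨hz, ?_⟩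
  intro h
  exact hx (congrArg Prod.fst h)

lemma hopfBarrier_contDiffAt (s A B : ℝ) (c : Euc N) {q : Euc N × ℝ} (hq : 0 < q.2) :
    ContDiffAt ℝ 2
      (fun q : Euc N × ℝ => q.2 ^ (2 * s) + A * q.2 ^ 2 - B * ‖q.1 - c‖ ^ 2) q :=
  ((contDiffAt_snd.rpow_const_of_ne hq.ne').add
    (contDiffAt_const.mul (contDiffAt_snd.pow 2))).sub
    (contDiffAt_const.mul (contDiff_norm_sub_sq c).contDiffAt)

lemma CSop_hopfBarrier (s A B : ℝ) (c : Euc N) {q : Euc N × ℝ} (hq : 0 < q.2) :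
    CSop N s (fun q : Euc N × ℝ => q.2 ^ (2 * s) + A * q.2 ^ 2 - B * ‖q.1 - c‖ ^ 2) q
      = q.2 ^ (1 - 2 * s) * (4 * A * (1 - s) - 2 * N * B) := by
  obtain ⟨x, z⟩ := q
  change 0 < z at hq
  have hg : ∀ r : ℝ, HasDerivAt (fun r => z ^ (2 * s) + A * z ^ 2 - B * r) (-B) r := fun r => by
    simpa using ((hasDerivAt_id r).const_mul B).const_sub (z ^ (2 * s) + A * z ^ 2)
  have hh : ∀ w : ℝ, 0 < w → HasDerivAt
      (fun w => w ^ (2 * s) + A * w ^ 2 - B * ‖x - c‖ ^ 2)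
      (2 * s * w ^ (2 * s - 1) + A * (2 * w)) w := fun w hw => by
    have h := ((Real.hasDerivAt_rpow_const (p := 2 * s) (Or.inl hw.ne')).add
      (((hasDerivAt_id w).pow 2).const_mul A)).sub_const (B * ‖x - c‖ ^ 2)
    exact h.congr_deriv (by simp)
  have hh' : HasDerivAt (fun w : ℝ => 2 * s * w ^ (2 * s - 1) + A * (2 * w))
      (2 * s * ((2 * s - 1) * z ^ (2 * s - 1 - 1)) + A * 2) z := by
    have h := ((Real.hasDerivAt_rpow_const (p := 2 * s - 1) (Or.inl hq.ne')).const_mul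
      (2 * s)).add (((hasDerivAt_id z).const_mul 2).const_mul A)
    exact h.congr_deriv (by simp)
  rw [CSop_eq_of_radial s (hopfBarrier_contDiffAt s A B c hq) c (fun _ => rfl)
    (Eventually.of_forall hg) (hasDerivAt_const _ _)
    ((lt_mem_nhds hq).mono hh) hh', rpow_neg_two_mul hq, Real.rpow_sub_one hq.ne' (2 * s - 1)]
  field_simp
  ring

lemma pos_on_boundary (hN : 1 ≤ N) (hs : s ∈ Ioo (0 : ℝ) 1) (hu : u ∈ SelfSimPos N s p 1)
    (hpos : ∀ q : Euc N × ℝ, 0 < q.2 → 0 < u q) {x₀ : Euc N} (hx₀ : x₀ ≠ 0) :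
    0 < u (x₀, 0) := by
  obtain ⟨⟨hcont, hC2, -, hL, hbd⟩, hnn⟩ := hu
  obtain ⟨hs0, hs1⟩ := hs
  have hN' : (1 : ℝ) ≤ N := by exact_mod_cast hN
  set ρ := ‖x₀‖ / 2 with hρdef
  have hρ : 0 < ρ := by have := norm_pos_iff.2 hx₀; positivity
  set κ := (1 - s) / N with hκdef
  have hκ : 0 < κ := div_pos (by linarith) (by linarith)
  have hκ1 : κ ≤ 1 := by rw [hκdef, div_le_one (by linarith)]; linarith
  set h := ρ * κ / 2 with hhdef
  have hh : 0 < h := by positivity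
  have hhs : 0 < h ^ (2 * s) := Real.rpow_pos_of_pos hh _
  set B := 2 * h ^ (2 * s) / ρ ^ 2 with hBdef
  have hB : 0 < B := by positivity
  set A := B / κ with hAdef
  have hA : 0 < A := by positivity
  have hlat : h ^ (2 * s) + A * h ^ 2 - B * ρ ^ 2 ≤ 0 := by
    have h1 : h ^ (2 * s) = B * ρ ^ 2 / 2 := by rw [hBdef]; field_simp
    have h2 : A * h ^ 2 = B * ρ ^ 2 * (κ / 4) := by rw [hAdef, hhdef]; field_simp; ring
    rw [h1, h2]
    have : 0 < B * ρ ^ 2 := by positivity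
    nlinarith
  set M := h ^ (2 * s) + A * h ^ 2 with hMdef
  have hM : 0 < M := by positivity
  have hK0 : ∀ x : Euc N, ‖x - x₀‖ ≤ ρ → x ≠ 0 := by
    rintro x hx rfl
    rw [zero_sub, norm_neg] at hx
    linarith
  set K : Set (Euc N × ℝ) := closedBall x₀ ρ ×ˢ Icc 0 h with hKdef
  have hKc : IsCompact K := (isCompact_closedBall _ _).prod isCompact_Icc
  have hKsub : K ⊆ {q : Euc N × ℝ | 0 ≤ q.2} \ {0} := by
    rintro ⟨x, z⟩ ⟨hx, hz⟩
    refine ⟨hz.1, fun h0 => hK0 x ?_ (congrArg Prod.fst h0)⟩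
    simpa [dist_eq_norm] using hx
  obtain ⟨η, hη, htop⟩ : ∃ η, 0 < η ∧ ∀ x ∈ closedBall x₀ ρ, η ≤ u (x, h) := by
    have hct : ContinuousOn (fun x => u (x, h)) (closedBall x₀ ρ) :=
      hC2.continuousOn.comp (f := fun x : Euc N => (x, h)) (by fun_prop) fun x _ => hh
    obtain ⟨y, -, hy⟩ := (isCompact_closedBall x₀ ρ).exists_isMinOn
      ⟨x₀, mem_closedBall_self hρ.le⟩ hct
    exact ⟨u (y, h), hpos _ hh, fun x hx => hy hx⟩
  set ε := η / M with hεdef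
  have hε : 0 < ε := by positivity
  set φ : Euc N × ℝ → ℝ := fun q => q.2 ^ (2 * s) + A * q.2 ^ 2 - B * ‖q.1 - x₀‖ ^ 2 with hφ
  have hφc : Continuous φ := by
    have : Continuous fun q : Euc N × ℝ => q.2 ^ (2 * s) :=
      continuous_snd.rpow_const fun _ => Or.inr (by linarith)
    fun_prop
  have hmono : ∀ z, 0 ≤ z → z ≤ h → z ^ (2 * s) + A * z ^ 2 ≤ M := by
    intro z hz hzh
    have h1 : z ^ (2 * s) ≤ h ^ (2 * s) := Real.rpow_le_rpow hz hzh (by linarith)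
    have h2 : z ^ 2 ≤ h ^ 2 := by gcongr
    rw [hMdef]; gcongr
  have key := nonneg_of_CSop_neg (s := s) hKc (v := fun q => 1 * u q + (-ε) * φ q)
    ((continuousOn_const.mul (hcont.mono hKsub)).add
      (continuousOn_const.mul hφc.continuousOn)) ?_
  · by_contra hle
    have hzero : u (x₀, 0) = 0 :=
      le_antisymm (not_lt.1 hle) (hnn _ le_rfl)
    have hlow : ∀ z, 0 < z → z ≤ h → ε * z ^ (2 * s) ≤ u (x₀, z) := by
      intro z hz hzh
      have := key (x₀, z) ⟨mem_closedBall_self hρ.le, hz.le, hzh⟩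
      simp only [hφ, sub_self, norm_zero] at this
      have h2 : 0 ≤ ε * (A * z ^ 2) := by positivity
      nlinarith
    have hev := eventually_lt_of_weighted_deriv_neg (s := s)
      (w := fun z => u (x₀, z) - ε / 2 * z ^ (2 * s))
      (w' := fun z => fderiv ℝ u (x₀, z) ((0 : Euc N), (1 : ℝ))
        - ε / 2 * (2 * s * z ^ (2 * s - 1))) (l := -(ε * s)) (by nlinarith)
      ((continuousOn_vertical hcont hx₀).sub (continuousOn_const.mul
        (continuousOn_id.rpow_const fun _ _ => Or.inr (by linarith)))) ?_ ?_
    · obtain ⟨z, h1, h2, h3⟩ := (hev.and (Ioc_mem_nhdsGT hh)).exists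
      rw [hzero, Real.zero_rpow (by linarith), mul_zero, sub_zero] at h1
      have h4 := hlow z h2 h3
      have h5 : 0 < z ^ (2 * s) := Real.rpow_pos_of_pos h2 _
      nlinarith
    · intro z hz
      exact (hasDerivAt_vertical ((contDiffAt_of_upper hC2 hz).differentiableAt
        (by simp))).sub ((Real.hasDerivAt_rpow_const (Or.inl hz.ne')).const_mul _)
    · have h1 := (hbd x₀ hx₀).sub_const (ε * s)
      rw [hzero, mul_zero, zero_sub] at h1
      refine h1.congr' ?_
      filter_upwards [self_mem_nhdsWithin] with z hz
      have : z ^ (1 - 2 * s) * z ^ (2 * s - 1) = 1 := by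
        rw [← Real.rpow_add hz]; simp
      linear_combination (ε * s) * this
  · rintro ⟨x, z⟩ ⟨hx, hz0, hzh⟩
    change 0 ≤ z at hz0
    change z ≤ h at hzh
    have hx' : ‖x - x₀‖ ≤ ρ := by simpa [dist_eq_norm] using hx
    have hu0 : 0 ≤ u (x, z) := hnn _ hz0
    have hle0 : φ (x, z) ≤ 0 → 0 ≤ 1 * u (x, z) + -ε * φ (x, z) := fun h => by nlinarith
    rcases eq_or_lt_of_le hz0 with rfl | hz0
    · refine Or.inl (hle0 ?_)
      simp only [hφ]
      rw [Real.zero_rpow (by linarith)]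
      have : 0 ≤ B * ‖x - x₀‖ ^ 2 := by positivity
      nlinarith
    rcases eq_or_lt_of_le hzh with rfl | hzh
    · left
      have h1 := htop x hx
      have h2 : φ (x, h) ≤ M := by
        have : 0 ≤ B * ‖x - x₀‖ ^ 2 := by positivity
        simp only [hφ]; linarith
      have h3 : ε * φ (x, h) ≤ η := by
        calc ε * φ (x, h) ≤ ε * M := by gcongr
          _ = η := by rw [hεdef]; field_simp
      linarith
    rcases eq_or_lt_of_le hx' with hxe | hxl
    · refine Or.inl (hle0 ?_)
      simp only [hφ]
      rw [hxe]
      have := hmono z hz0.le hzh.le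
      linarith
    right
    have hφat := hopfBarrier_contDiffAt s A B x₀ (q := (x, z)) hz0
    have huat := contDiffAt_of_upper hC2 (q := (x, z)) hz0
    refine ⟨?_, hz0, (contDiffAt_const.mul huat).add (contDiffAt_const.mul hφat), ?_⟩
    · exact prod_mem_nhds (closedBall_mem_nhds_of_mem (by simpa [dist_eq_norm] using hxl))
        (Icc_mem_nhds hz0 hzh)
    · rw [CSop_linear_comb s _ _ huat hφat, hL _ hz0, CSop_hopfBarrier s A B x₀ hz0]
      have h1 : 0 < z ^ (1 - 2 * s) := Real.rpow_pos_of_pos hz0 _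
      have h2 : A * (1 - s) = N * B := by
        rw [hAdef, hκdef]; field_simp
      have h3 : 4 * A * (1 - s) - 2 * N * B = 2 * (N * B) := by linear_combination 4 * h2
      rw [h3]
      have : 0 < ε * (z ^ (1 - 2 * s) * (2 * (N * B))) := by positivity
      simp only [mul_zero, zero_add, neg_mul]
      linarith

lemma selfSimPos_pos_of_ne_zero (hN : 1 ≤ N) (hs : s ∈ Ioo (0 : ℝ) 1) (hu : u ∈ SelfSimPos N s p 1)
    (hne : ∃ q : Euc N × ℝ, 0 ≤ q.2 ∧ q ≠ 0 ∧ u q ≠ 0) (q : Euc N × ℝ) (hq : 0 ≤ q.2)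
    (hq0 : q ≠ 0) : 0 < u q := by
  have hu' := hu
  obtain ⟨⟨hcont, hC2, -, hL, -⟩, hnn⟩ := hu'
  have hinner : ∀ q : Euc N × ℝ, 0 < q.2 → 0 < u q := by
    refine pos_of_exists_pos hs hC2 (fun q hq => hnn q hq.le) hL ?_
    obtain ⟨⟨x, z⟩, hz, hxz, hne⟩ := hne
    change 0 ≤ z at hz
    have hpos := lt_of_le_of_ne (hnn (x, z) hz) (Ne.symm hne)
    rcases eq_or_lt_of_le hz with rfl | hz
    · have hx : x ≠ 0 := by
        rintro rfl
        exact hxz rfl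
      have hc := ((continuousOn_vertical hcont hx) 0 self_mem_Ici).mono Ioi_subset_Ici_self
      obtain ⟨z, h1, h2⟩ := ((hc.eventually (lt_mem_nhds hpos)).and self_mem_nhdsWithin).exists
      exact ⟨(x, z), h2, h1⟩
    · exact ⟨(x, z), hz, hpos⟩
  obtain ⟨x, z⟩ := q
  change 0 ≤ z at hq
  rcases eq_or_lt_of_le hq with rfl | hz
  · exact pos_on_boundary hN hs hu hinner fun hx => hq0 (by rw [hx]; rfl)
  · exact hinner _ hz

end Comparison

section Uniqueness

variable {N : ℕ} {s p : ℝ}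

lemma radius_sq_pos {q : Euc N × ℝ} (hq : q ≠ 0) : 0 < ‖q.1‖ ^ 2 + q.2 ^ 2 := by
  by_contra! h
  have h1 := sq_nonneg ‖q.1‖
  have h2 := sq_nonneg q.2
  refine hq (Prod.ext ?_ ?_)
  · simpa using (show ‖q.1‖ ^ 2 = 0 by linarith)
  · simpa using (show q.2 ^ 2 = 0 by linarith)

lemma contDiff_radius_sq : ContDiff ℝ 2 (fun q : Euc N × ℝ => ‖q.1‖ ^ 2 + q.2 ^ 2) :=
  (contDiff_fst.norm_sq ℝ).add (contDiff_snd.pow 2)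

lemma radius_rpow_contDiffAt (a : ℝ) {q : Euc N × ℝ} (hq : q ≠ 0) :
    ContDiffAt ℝ 2 (fun q : Euc N × ℝ => (‖q.1‖ ^ 2 + q.2 ^ 2) ^ a) q :=
  contDiff_radius_sq.contDiffAt.rpow_const_of_ne (radius_sq_pos hq).ne'

lemma hasDerivAt_rpow_add_sq (a r : ℝ) {w : ℝ} (h : 0 < r + w ^ 2) :
    HasDerivAt (fun w : ℝ => (r + w ^ 2) ^ a) (2 * a * w * (r + w ^ 2) ^ (a - 1)) w := by
  have := (((hasDerivAt_id w).pow 2).const_add r).rpow_const (p := a) (Or.inl h.ne')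
  exact this.congr_deriv (by simp only [id, Pi.pow_apply, Nat.cast_ofNat, Nat.add_one_sub_one, pow_one]; ring)

lemma CSop_radius_rpow (s a : ℝ) {q : Euc N × ℝ} (hq : 0 < q.2) :
    CSop N s (fun q : Euc N × ℝ => (‖q.1‖ ^ 2 + q.2 ^ 2) ^ a) q
      = q.2 ^ (1 - 2 * s) * (‖q.1‖ ^ 2 + q.2 ^ 2) ^ (a - 1) * (4 * a * (a - s + N / 2)) := by
  obtain ⟨x, z⟩ := q
  change 0 < z at hq
  have hne : (x, z) ≠ (0 : Euc N × ℝ) := fun h => hq.ne' (congrArg Prod.snd h)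
  have hX : 0 < ‖x‖ ^ 2 + z ^ 2 := by positivity
  have hg : ∀ b r : ℝ, 0 < r + z ^ 2 → HasDerivAt (fun r => (r + z ^ 2) ^ b)
      (b * (r + z ^ 2) ^ (b - 1)) r := fun b r hr => by
    have := ((hasDerivAt_id r).add_const (z ^ 2)).rpow_const (p := b) (Or.inl hr.ne')
    exact this.congr_deriv (by simp)
  have hh' := ((hasDerivAt_id z).const_mul (2 * a)).mul
    (hasDerivAt_rpow_add_sq (a - 1) (‖x‖ ^ 2) hX)
  have hev : ∀ᶠ r in 𝓝 (‖x - 0‖ ^ 2), 0 < r + z ^ 2 := by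
    rw [sub_zero]
    exact (continuous_add_const (z ^ 2)).continuousAt.eventually (lt_mem_nhds hX)
  have hev' : ∀ᶠ w in 𝓝 z, 0 < ‖x‖ ^ 2 + w ^ 2 :=
    (show Continuous fun w : ℝ => ‖x‖ ^ 2 + w ^ 2 by fun_prop).continuousAt.eventually
      (lt_mem_nhds hX)
  rw [CSop_eq_of_radial s (radius_rpow_contDiffAt a hne) 0 (fun _ => by rw [sub_zero])
    (hev.mono (hg a)) ((hg (a - 1) _ hev.self_of_nhds).const_mul a)
    (hev'.mono fun w => hasDerivAt_rpow_add_sq a _) hh', rpow_neg_two_mul hq, sub_zero,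
    Real.rpow_sub_one hX.ne' (a - 1)]
  simp only [id]
  field_simp
  ring

lemma rpow_scale {p s l : ℝ} (hl : 0 < l) {X : ℝ} (hX : 0 ≤ X) :
    (l ^ 2 * X) ^ (-(s / (p - 1))) = l ^ (-(2 * s) / (p - 1)) * X ^ (-(s / (p - 1))) := by
  rw [Real.mul_rpow (by positivity) hX, ← Real.rpow_natCast, ← Real.rpow_mul hl.le]
  congr 2
  push_cast
  ring

/-- Comparison of homogeneous solutions. -/
lemma selfSimPos_le (hs : s ∈ Ioo (0 : ℝ) 1) (hp : 1 < p)
    (hsub : ((N : ℝ) - 2 * s) / 2 < s / (p - 1)) {f g : Euc N × ℝ → ℝ}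
    (hf : f ∈ SelfSimPos N s p 1) (hg : g ∈ SelfSim N s p 1)
    (hgpos : ∀ q : Euc N × ℝ, 0 ≤ q.2 → q ≠ 0 → 0 < g q) :
    ∀ q : Euc N × ℝ, 0 ≤ q.2 → q ≠ 0 → f q ≤ g q := by
  obtain ⟨hs0, hs1⟩ := hs
  obtain ⟨⟨hfc, hfC, hfh, hfL, hfb⟩, hfn⟩ := hf
  obtain ⟨hgc, hgC, hgh, hgL, hgb⟩ := hg
  by_contra! hcon
  set a := s / (p - 1) with ha
  have ha0 : 0 < a := div_pos hs0 (by linarith)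
  set S : Set (Euc N × ℝ) := {q | 0 ≤ q.2 ∧ ‖q.1‖ ^ 2 + q.2 ^ 2 = 1} with hS
  have hSne : ∀ q ∈ S, q ≠ 0 := by
    rintro q ⟨-, h⟩ rfl
    simp at h
  have hSsub : S ⊆ {q : Euc N × ℝ | 0 ≤ q.2} \ {0} := fun q hq => ⟨hq.1, hSne q hq⟩
  have hScl : IsClosed S := (isClosed_le continuous_const continuous_snd).inter
    (isClosed_eq contDiff_radius_sq.continuous continuous_const)
  have hSc : IsCompact S := by
    refine (isCompact_closedBall (0 : Euc N × ℝ) 1).of_isClosed_subset hScl ?_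
    rintro q ⟨-, h⟩
    rw [mem_closedBall_zero_iff, Prod.norm_def]
    have h1 := sq_nonneg ‖q.1‖
    have h2 := sq_nonneg q.2
    refine max_le (abs_le_of_sq_le_sq' (by linarith) zero_le_one).2
      (abs_le_of_sq_le_sq (by linarith) zero_le_one)
  have hproj : ∀ q : Euc N × ℝ, 0 ≤ q.2 → q ≠ 0 → ∃ l : ℝ, 0 < l ∧ ∃ w ∈ S,
      q = (l • w.1, l * w.2) := by
    intro q hq hq0
    have hr := radius_sq_pos hq0
    set l := √(‖q.1‖ ^ 2 + q.2 ^ 2) with hl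
    have hl0 : 0 < l := Real.sqrt_pos.2 hr
    have hl2 : l ^ 2 = ‖q.1‖ ^ 2 + q.2 ^ 2 := Real.sq_sqrt hr.le
    refine ⟨l, hl0, (l⁻¹ • q.1, l⁻¹ * q.2), ⟨by positivity, ?_⟩, ?_⟩
    · simp only [norm_smul, norm_inv, Real.norm_of_nonneg hl0.le]
      rw [mul_pow, mul_pow, ← mul_add, ← hl2]
      field_simp
    · ext <;> simp [hl0.ne']
  obtain ⟨q₀, hq₀S, hq₀⟩ : ∃ q ∈ S, g q < f q := by
    obtain ⟨q, hq, hq0, hlt⟩ := hcon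
    obtain ⟨l, hl, w, hw, rfl⟩ := hproj q hq hq0
    refine ⟨w, hw, ?_⟩
    rw [hfh l hl w, hgh l hl w] at hlt
    exact lt_of_mul_lt_mul_left hlt (Real.rpow_nonneg hl.le _)
  obtain ⟨qm, hqm, hmin⟩ := hSc.exists_isMinOn ⟨q₀, hq₀S⟩ (hgc.mono hSsub)
  set m := g qm with hm
  have hm0 : 0 < m := hgpos _ hqm.1 (hSne _ hqm)
  have hg₀ : 0 < g q₀ := hgpos _ hq₀S.1 (hSne _ hq₀S)
  set k₀ := f q₀ / g q₀ with hk₀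
  have hk₀1 : 1 < k₀ := (one_lt_div hg₀).2 hq₀
  obtain ⟨η, hη, ⟨hη0, hη1⟩⟩ : ∃ η : ℝ, 1 < (1 - η) ^ p * k₀ ^ (p - 1) ∧ η ∈ Ioo (0 : ℝ) 1 := by
    have hc : Tendsto (fun η : ℝ => (1 - η) ^ p * k₀ ^ (p - 1)) (𝓝[>] 0)
        (𝓝 ((1 - 0) ^ p * k₀ ^ (p - 1))) := by
      refine Tendsto.mono_left ?_ nhdsWithin_le_nhds
      have : ContinuousAt (fun η : ℝ => (1 - η) ^ p) 0 :=
        (continuousAt_const.sub continuousAt_id).rpow_const (Or.inl (by simp))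
      exact (this.mul continuousAt_const).tendsto
    rw [sub_zero, Real.one_rpow, one_mul] at hc
    exact ((hc.eventually (lt_mem_nhds (Real.one_lt_rpow hk₀1 (by linarith)))).and
      (Ioo_mem_nhdsGT one_pos)).exists
  set δ := η * m with hδ
  have hδ0 : 0 < δ := by positivity
  set b : Euc N × ℝ → ℝ := fun q => (‖q.1‖ ^ 2 + q.2 ^ 2) ^ (-a) with hb
  have hbS : ∀ q ∈ S, b q = 1 := by
    rintro q ⟨-, h⟩
    simp only [hb, h, Real.one_rpow]
  have hbh : ∀ l : ℝ, 0 < l → ∀ q : Euc N × ℝ,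
      b (l • q.1, l * q.2) = l ^ (-(2 * s) / (p - 1)) * b q := by
    intro l hl q
    simp only [hb, norm_smul, Real.norm_of_nonneg hl.le]
    rw [← rpow_scale hl (by positivity)]
    congr 1
    ring
  have hGlow : ∀ q ∈ S, (1 - η) * g q ≤ g q - δ := by
    intro q hq
    have : m ≤ g q := hmin hq
    rw [hδ]
    nlinarith
  have hGpos : ∀ q ∈ S, 0 < g q - δ := fun q hq =>
    (mul_pos (by linarith) (hgpos q hq.1 (hSne q hq))).trans_le (hGlow q hq)
  obtain ⟨qs, hqs, hmax⟩ := hSc.exists_isMaxOn (f := fun q => f q / (g q - δ)) ⟨q₀, hq₀S⟩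
    ((hfc.mono hSsub).div ((hgc.mono hSsub).sub continuousOn_const) fun q hq => (hGpos q hq).ne')
  set k := f qs / (g qs - δ) with hk
  have hkk : k₀ ≤ k := by
    refine le_trans ?_ (hmax hq₀S)
    exact div_le_div_of_nonneg_left (hfn _ hq₀S.1) (hGpos _ hq₀S) (by linarith)
  have hk0 : 0 < k := by linarith
  have hfs : f qs = k * (g qs - δ) := by
    rw [hk]; field_simp [(hGpos _ hqs).ne']
  set V : Euc N × ℝ → ℝ := fun q => 1 * (k * g q + (-1) * f q) + (-(k * δ)) * b q with hV
  have hVnn : ∀ q : Euc N × ℝ, 0 ≤ q.2 → q ≠ 0 → 0 ≤ V q := by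
    intro q hq hq0
    obtain ⟨l, hl, w, hw, rfl⟩ := hproj q hq hq0
    have h1 : f w ≤ k * (g w - δ) := (div_le_iff₀ (hGpos w hw)).1 (hmax hw)
    have h2 : V (l • w.1, l * w.2) = l ^ (-(2 * s) / (p - 1)) * (k * (g w - δ) - f w) := by
      simp only [hV]
      rw [hfh l hl, hgh l hl, hbh l hl, hbS w hw]
      ring
    rw [h2]
    exact mul_nonneg (Real.rpow_nonneg hl.le _) (by linarith)
  have hVs : V qs = 0 := by
    simp only [hV]
    rw [hbS qs hqs, hfs]
    ring
  obtain ⟨x, z⟩ := qs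
  have hz : 0 ≤ z := hqs.1
  rcases eq_or_lt_of_le hz with rfl | hz
  · have hx1 : ‖x‖ ^ 2 = 1 := by simpa using hqs.2
    have hx : x ≠ 0 := by
      rintro rfl
      simp at hx1
    have hgx : 0 < g (x, 0) := hgpos _ le_rfl (hSne _ hqs)
    have hlneg : 1 * (k * (1 * |g (x, 0)| ^ (p - 1) * g (x, 0))
        + (-1) * (1 * |f (x, 0)| ^ (p - 1) * f (x, 0))) + (-(k * δ)) * 0 < 0 := by
      have hpow : ∀ t : ℝ, 0 < t → |t| ^ (p - 1) * t = t ^ p := by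
        intro t ht
        rw [abs_of_pos ht, ← Real.rpow_add_one ht.ne', sub_add_cancel]
      have hfx : 0 < f (x, 0) := by
        rw [hfs]; exact mul_pos hk0 (hGpos _ hqs)
      simp only [one_mul, mul_zero, add_zero, hpow _ hgx, hpow _ hfx]
      have h1 : k ^ p * ((1 - η) ^ p * g (x, 0) ^ p) ≤ f (x, 0) ^ p := by
        rw [← Real.mul_rpow (by linarith) hgx.le, ← Real.mul_rpow hk0.le (by nlinarith), hfs]
        refine Real.rpow_le_rpow (by nlinarith [mul_pos hk0 (mul_pos (sub_pos.2 hη1) hgx)])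
          ?_ (by linarith)
        exact mul_le_mul_of_nonneg_left (hGlow _ hqs) hk0.le
      have h2 : 1 < (1 - η) ^ p * k ^ (p - 1) := hη.trans_le (by
        refine mul_le_mul_of_nonneg_left ?_ (Real.rpow_nonneg (by linarith) _)
        exact Real.rpow_le_rpow (by linarith) hkk (by linarith))
      have h3 : k ^ p = k * k ^ (p - 1) := by
        rw [mul_comm, ← Real.rpow_add_one hk0.ne', sub_add_cancel]
      have h4 : 0 < k * g (x, 0) ^ p := mul_pos hk0 (Real.rpow_pos_of_pos hgx _)
      rw [h3] at h1
      nlinarith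
    have hbc : ContinuousOn b ({q : Euc N × ℝ | 0 ≤ q.2} \ {0}) := fun q hq =>
      (radius_rpow_contDiffAt (-a) hq.2).continuousAt.continuousWithinAt
    have hVc : ContinuousOn V ({q : Euc N × ℝ | 0 ≤ q.2} \ {0}) :=
      (continuousOn_const.mul ((continuousOn_const.mul hgc).add (continuousOn_const.mul hfc))).add
        (continuousOn_const.mul hbc)
    have hbz : Tendsto (fun z : ℝ => z ^ (1 - 2 * s) *
        (2 * -a * z * (‖x‖ ^ 2 + z ^ 2) ^ (-a - 1))) (𝓝[>] 0) (𝓝 0) := by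
      have h1 : Tendsto (fun z : ℝ => z ^ (2 - 2 * s) *
          (2 * -a * (‖x‖ ^ 2 + z ^ 2) ^ (-a - 1))) (𝓝[>] 0)
          (𝓝 ((0 : ℝ) ^ (2 - 2 * s) * (2 * -a * (‖x‖ ^ 2 + 0 ^ 2) ^ (-a - 1)))) := by
        refine Tendsto.mono_left ?_ nhdsWithin_le_nhds
        have h2 : ContinuousAt (fun z : ℝ => z ^ (2 - 2 * s)) 0 :=
          continuousAt_id.rpow_const (Or.inr (by linarith))
        have h3 : ContinuousAt (fun z : ℝ => (‖x‖ ^ 2 + z ^ 2) ^ (-a - 1)) 0 :=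
          (continuousAt_const.add (continuousAt_id.pow 2)).rpow_const (Or.inl (by simp [hx]))
        exact (h2.mul (continuousAt_const.mul h3)).tendsto
      rw [Real.zero_rpow (by linarith), zero_mul] at h1
      refine h1.congr' ?_
      filter_upwards [self_mem_nhdsWithin] with z hz
      have hz : 0 < z := hz
      rw [show 2 - 2 * s = (1 - 2 * s) + 1 by ring, Real.rpow_add_one hz.ne']
      ring
    have hev := eventually_lt_of_weighted_deriv_neg (s := s) (w := fun z => V (x, z))
      (w' := fun z => 1 * (k * fderiv ℝ g (x, z) ((0 : Euc N), (1 : ℝ))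
        + (-1) * fderiv ℝ f (x, z) ((0 : Euc N), (1 : ℝ)))
        + (-(k * δ)) * (2 * -a * z * (‖x‖ ^ 2 + z ^ 2) ^ (-a - 1))) hlneg
      (continuousOn_vertical hVc hx) ?_ ?_
    · obtain ⟨z, h1, h2⟩ := (hev.and self_mem_nhdsWithin).exists
      have h3 := hVnn (x, z) (le_of_lt h2) fun h => hx (congrArg Prod.fst h)
      rw [hVs] at h1
      linarith
    · intro z hz
      have h1 := hasDerivAt_vertical ((contDiffAt_of_upper hgC (q := (x, z)) hz).differentiableAt
        (by simp))
      have h2 := hasDerivAt_vertical ((contDiffAt_of_upper hfC (q := (x, z)) hz).differentiableAt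
        (by simp))
      exact (((h1.const_mul k).add (h2.const_mul (-1))).const_mul 1).add
        ((hasDerivAt_rpow_add_sq (-a) (‖x‖ ^ 2) (by positivity)).const_mul (-(k * δ)))
    · refine (((((hgb x hx).const_mul k).add ((hfb x hx).const_mul (-1))).const_mul 1).add
        (hbz.const_mul (-(k * δ)))).congr fun z => ?_
      ring
  · have hne : (x, z) ≠ (0 : Euc N × ℝ) := hSne _ hqs
    have hgat := contDiffAt_of_upper hgC (q := (x, z)) hz
    have hfat := contDiffAt_of_upper hfC (q := (x, z)) hz
    have hbat := radius_rpow_contDiffAt (-a) hne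
    have hfgat : ContDiffAt ℝ 2 (fun q => k * g q + (-1) * f q) (x, z) :=
      (contDiffAt_const.mul hgat).add (contDiffAt_const.mul hfat)
    have hVat : ContDiffAt ℝ 2 V (x, z) :=
      (contDiffAt_const.mul hfgat).add (contDiffAt_const.mul hbat)
    have hloc : IsLocalMin V (x, z) := by
      filter_upwards [isOpen_upper.mem_nhds hz] with q hq
      rw [hVs]
      refine hVnn q (le_of_lt hq) ?_
      rintro rfl
      exact lt_irrefl _ hq
    have h1 := CSop_nonneg_of_isLocalMin s hVat hz hloc
    rw [CSop_linear_comb s _ _ hfgat hbat, CSop_linear_comb s _ _ hgat hfat, hgL _ hz, hfL _ hz,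
      CSop_radius_rpow s (-a) hz] at h1
    have h2 : 0 < z ^ (1 - 2 * s) := Real.rpow_pos_of_pos hz _
    have h3 : 0 < (‖x‖ ^ 2 + z ^ 2) ^ (-a - 1) := Real.rpow_pos_of_pos (by positivity) _
    have h4 : 0 < 4 * -a * (-a - s + N / 2) := by nlinarith
    have h5 := mul_pos (mul_pos hk0 hδ0) (mul_pos (mul_pos h2 h3) h4)
    simp only [mul_zero, add_zero, zero_add, neg_mul] at h1 h5
    linarith

end Uniqueness

section Kernel

/-- The integrand of `kernInt`. -/
noncomputable def kern (A B b : ℝ) (q : ℝ × ℝ) (t : ℝ) : ℝ :=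
  (q.1 + t) ^ A * (q.2 + t) ^ B * t ^ (b - 1)

/-- The Euler-type integral `∫₀^∞ (R + t)^A (y + t)^B t^(b-1) dt` at `q = (R, y)`. -/
noncomputable def kernInt (A B b : ℝ) (q : ℝ × ℝ) : ℝ := ∫ t in Ioi (0 : ℝ), kern A B b q t

variable {A B b : ℝ}

lemma measurable_kern (A B b : ℝ) (q : ℝ × ℝ) : Measurable (kern A B b q) := by
  unfold kern
  exact (((measurable_const.add measurable_id).pow_const A).mul
    ((measurable_const.add measurable_id).pow_const B)).mul (measurable_id.pow_const (b - 1))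

lemma kern_nonneg {q : ℝ × ℝ} (h1 : 0 ≤ q.1) (h2 : 0 ≤ q.2) {t : ℝ} (ht : 0 ≤ t) :
    0 ≤ kern A B b q t := by
  unfold kern; positivity

lemma kern_pos {q : ℝ × ℝ} (h1 : 0 ≤ q.1) (h2 : 0 ≤ q.2) {t : ℝ} (ht : 0 < t) :
    0 < kern A B b q t := by
  unfold kern; positivity

lemma rpow_le_of_mem_Icc {m M x : ℝ} (hm : 0 < m) (h1 : m ≤ x) (h2 : x ≤ M) (C : ℝ) :
    x ^ C ≤ m ^ C + M ^ C := by
  have hx : 0 < x := hm.trans_le h1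
  have hM : 0 < M := hx.trans_le h2
  rcases le_total 0 C with hC | hC
  · have := Real.rpow_le_rpow hx.le h2 hC
    have := Real.rpow_nonneg hm.le C
    linarith
  · have := Real.rpow_le_rpow_of_nonpos hm h1 hC
    have := Real.rpow_nonneg hM.le C
    linarith

lemma add_rpow_le {m M y t : ℝ} (hm : 0 < m) (hm1 : m ≤ 1) (hM : 1 ≤ M) (h1 : m ≤ y)
    (h2 : y ≤ M) (ht : 0 ≤ t) (C : ℝ) : (y + t) ^ C ≤ (m ^ C + M ^ C) * (1 + t) ^ C := by
  have h1t : 0 < 1 + t := by linarith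
  have h := rpow_le_of_mem_Icc (m := m) (M := M) (x := (y + t) / (1 + t)) hm
    (by rw [le_div_iff₀ h1t]; nlinarith) (by rw [div_le_iff₀ h1t]; nlinarith) C
  rwa [Real.div_rpow (by linarith) h1t.le, div_le_iff₀ (Real.rpow_pos_of_pos h1t _)] at h

lemma integrableOn_one_add_rpow_mul {C : ℝ} (hb : 0 < b) (hC : C + b < 0) :
    IntegrableOn (fun t : ℝ => (1 + t) ^ C * t ^ (b - 1)) (Ioi 0) := by
  have hmeas : Measurable fun t : ℝ => (1 + t) ^ C * t ^ (b - 1) :=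
    ((measurable_const.add measurable_id).pow_const C).mul (measurable_id.pow_const (b - 1))
  rw [← Ioc_union_Ioi_eq_Ioi zero_le_one]
  refine IntegrableOn.union ?_ ?_
  · have h : IntegrableOn (fun t : ℝ => (1 ^ C + 2 ^ C) * t ^ (b - 1)) (Ioc 0 1) := by
      rw [integrableOn_Ioc_iff_integrableOn_Ioo]
      exact ((intervalIntegral.integrableOn_Ioo_rpow_iff one_pos).2 (by linarith)).const_mul _
    refine Integrable.mono' h hmeas.aestronglyMeasurable ?_
    filter_upwards [ae_restrict_mem measurableSet_Ioc] with t ht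
    have h0 : 0 < t := ht.1
    rw [Real.norm_of_nonneg (by positivity)]
    exact mul_le_mul_of_nonneg_right
      (rpow_le_of_mem_Icc one_pos (by linarith) (by linarith [ht.2]) C) (by positivity)
  · have h : IntegrableOn (fun t : ℝ => (1 ^ C + 2 ^ C) * t ^ (C + b - 1)) (Ioi 1) :=
      (integrableOn_Ioi_rpow_of_lt (by linarith) one_pos).const_mul _
    refine Integrable.mono' h hmeas.aestronglyMeasurable ?_
    filter_upwards [ae_restrict_mem measurableSet_Ioi] with t ht
    have h1 : 1 < t := ht
    have h0 : 0 < t := by linarith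
    rw [Real.norm_of_nonneg (by positivity)]
    have h2 : ((1 + t) / t) ^ C ≤ 1 ^ C + 2 ^ C := rpow_le_of_mem_Icc one_pos
      (by rw [le_div_iff₀ h0]; linarith) (by rw [div_le_iff₀ h0]; linarith) C
    rw [Real.div_rpow (by linarith) h0.le, div_le_iff₀ (by positivity)] at h2
    calc (1 + t) ^ C * t ^ (b - 1) ≤ (1 ^ C + 2 ^ C) * t ^ C * t ^ (b - 1) := by gcongr
      _ = (1 ^ C + 2 ^ C) * t ^ (C + b - 1) := by
        rw [mul_assoc, ← Real.rpow_add h0]; congr 2; ring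

lemma kern_le {m M : ℝ} {q : ℝ × ℝ} (hm : 0 < m) (hm1 : m ≤ 1) (hM : 1 ≤ M)
    (h1 : q.1 ∈ Icc m M) (h2 : q.2 ∈ Icc m M) (A B b : ℝ) {t : ℝ} (ht : 0 ≤ t) :
    kern A B b q t ≤
      (m ^ A + M ^ A) * (m ^ B + M ^ B) * ((1 + t) ^ (A + B) * t ^ (b - 1)) := by
  have hq2 : 0 ≤ q.2 := hm.le.trans h2.1
  have hM0 : 0 < M := by linarith
  calc kern A B b q t ≤ ((m ^ A + M ^ A) * (1 + t) ^ A) * ((m ^ B + M ^ B) * (1 + t) ^ B)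
        * t ^ (b - 1) := by
        unfold kern
        gcongr
        · exact add_rpow_le hm hm1 hM h1.1 h1.2 ht A
        · exact add_rpow_le hm hm1 hM h2.1 h2.2 ht B
    _ = _ := by rw [Real.rpow_add (by linarith : 0 < 1 + t)]; ring

lemma exists_box {q : ℝ × ℝ} (h1 : 0 < q.1) (h2 : 0 < q.2) :
    ∃ m M : ℝ, 0 < m ∧ m ≤ 1 ∧ 1 ≤ M ∧ q.1 ∈ Ioo m M ∧ q.2 ∈ Ioo m M := by
  refine ⟨min 1 (min q.1 q.2) / 2, max 1 (max q.1 q.2) * 2, ?_⟩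
  have e1 := min_le_left 1 (min q.1 q.2)
  have e2 := min_le_right 1 (min q.1 q.2)
  have e3 := min_le_left q.1 q.2
  have e4 := min_le_right q.1 q.2
  have f1 := le_max_left 1 (max q.1 q.2)
  have f2 := le_max_right 1 (max q.1 q.2)
  have f3 := le_max_left q.1 q.2
  have f4 := le_max_right q.1 q.2
  have e0 : 0 < min 1 (min q.1 q.2) := lt_min one_pos (lt_min h1 h2)
  refine ⟨by linarith, by linarith, by linarith, ⟨?_, ?_⟩, ?_, ?_⟩ <;> linarith

lemma integrableOn_kern (hb : 0 < b) (hAB : A + B + b < 0) {q : ℝ × ℝ} (h1 : 0 < q.1)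
    (h2 : 0 < q.2) : IntegrableOn (kern A B b q) (Ioi 0) := by
  obtain ⟨m, M, hm, hm1, hM, hq1, hq2⟩ := exists_box h1 h2
  refine Integrable.mono' ((integrableOn_one_add_rpow_mul hb hAB).const_mul
    ((m ^ A + M ^ A) * (m ^ B + M ^ B))) (measurable_kern A B b q).aestronglyMeasurable ?_
  filter_upwards [ae_restrict_mem measurableSet_Ioi] with t ht
  rw [Real.norm_of_nonneg (kern_nonneg h1.le h2.le (le_of_lt ht))]
  exact kern_le hm hm1 hM (Ioo_subset_Icc_self hq1) (Ioo_subset_Icc_self hq2) A B b (le_of_lt ht)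

lemma hasFDerivAt_kern (A B b : ℝ) {q : ℝ × ℝ} (h1 : 0 < q.1) (h2 : 0 < q.2) {t : ℝ}
    (ht : 0 < t) : HasFDerivAt (fun q => kern A B b q t)
      ((A * kern (A - 1) B b q t) • ContinuousLinearMap.fst ℝ ℝ ℝ
        + (B * kern A (B - 1) b q t) • ContinuousLinearMap.snd ℝ ℝ ℝ) q := by
  have e1 : HasFDerivAt (fun q : ℝ × ℝ => q.1 + t) (ContinuousLinearMap.fst ℝ ℝ ℝ) q :=
    hasFDerivAt_fst.add_const t
  have e2 : HasFDerivAt (fun q : ℝ × ℝ => q.2 + t) (ContinuousLinearMap.snd ℝ ℝ ℝ) q :=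
    hasFDerivAt_snd.add_const t
  have p1 := e1.rpow_const (p := A) (Or.inl (by positivity : q.1 + t ≠ 0))
  have p2 := e2.rpow_const (p := B) (Or.inl (by positivity : q.2 + t ≠ 0))
  refine ((p1.mul p2).mul_const (t ^ (b - 1))).congr_fderiv ?_
  ext <;> simp [kern] <;> ring

lemma hasFDerivAt_kernInt (hb : 0 < b) (hAB : A + B + b < 0) {q : ℝ × ℝ} (h1 : 0 < q.1)
    (h2 : 0 < q.2) : HasFDerivAt (kernInt A B b)
      ((A * kernInt (A - 1) B b q) • ContinuousLinearMap.fst ℝ ℝ ℝ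
        + (B * kernInt A (B - 1) b q) • ContinuousLinearMap.snd ℝ ℝ ℝ) q := by
  obtain ⟨m, M, hm, hm1, hM, hq1, hq2⟩ := exists_box h1 h2
  have i1 := (integrableOn_kern (A := A - 1) (B := B) hb (by linarith) h1 h2).const_mul A
  have i2 := (integrableOn_kern (A := A) (B := B - 1) hb (by linarith) h1 h2).const_mul B
  have j1 := i1.smul_const (ContinuousLinearMap.fst ℝ ℝ ℝ)
  have j2 := i2.smul_const (ContinuousLinearMap.snd ℝ ℝ ℝ)
  have hderiv := hasFDerivAt_integral_of_dominated_of_fderiv_le (𝕜 := ℝ)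
    (μ := volume.restrict (Ioi (0 : ℝ))) (F := kern A B b)
    (F' := fun q t => (A * kern (A - 1) B b q t) • ContinuousLinearMap.fst ℝ ℝ ℝ
        + (B * kern A (B - 1) b q t) • ContinuousLinearMap.snd ℝ ℝ ℝ)
    (bound := fun t => (|A| * ((m ^ (A - 1) + M ^ (A - 1)) * (m ^ B + M ^ B))
      + |B| * ((m ^ A + M ^ A) * (m ^ (B - 1) + M ^ (B - 1)))) *
        ((1 + t) ^ (A + B - 1) * t ^ (b - 1)))
    (s := Ioo m M ×ˢ Ioo m M) (x₀ := q)
    (prod_mem_nhds (Ioo_mem_nhds hq1.1 hq1.2) (Ioo_mem_nhds hq2.1 hq2.2))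
    (Eventually.of_forall fun q => (measurable_kern A B b q).aestronglyMeasurable)
    (integrableOn_kern hb hAB h1 h2)
    (j1.add j2).aestronglyMeasurable ?_
    ((integrableOn_one_add_rpow_mul hb (by linarith)).const_mul _) ?_
  · refine hderiv.congr_fderiv ?_
    rw [integral_add j1 j2, integral_smul_const,
      integral_smul_const, integral_const_mul, integral_const_mul]
    rfl
  · filter_upwards [ae_restrict_mem measurableSet_Ioi] with t ht w hw
    have hw1 := Ioo_subset_Icc_self hw.1
    have hw2 := Ioo_subset_Icc_self hw.2
    have n1 : 0 ≤ w.1 := hm.le.trans hw1.1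
    have n2 : 0 ≤ w.2 := hm.le.trans hw2.1
    have ht' : 0 ≤ t := le_of_lt ht
    have k1 := kern_le hm hm1 hM hw1 hw2 (A - 1) B b ht'
    have k2 := kern_le hm hm1 hM hw1 hw2 A (B - 1) b ht'
    rw [show A - 1 + B = A + B - 1 by ring] at k1
    rw [show A + (B - 1) = A + B - 1 by ring] at k2
    refine (norm_add_le _ _).trans ?_
    rw [norm_smul, norm_smul, norm_mul, norm_mul, Real.norm_of_nonneg (kern_nonneg n1 n2 ht'),
      Real.norm_of_nonneg (kern_nonneg n1 n2 ht'), Real.norm_eq_abs, Real.norm_eq_abs]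
    have f1 := ContinuousLinearMap.norm_fst_le ℝ ℝ ℝ
    have f2 := ContinuousLinearMap.norm_snd_le ℝ ℝ ℝ
    have g1 : |A| * kern (A - 1) B b w t * ‖ContinuousLinearMap.fst ℝ ℝ ℝ‖
        ≤ |A| * kern (A - 1) B b w t :=
      mul_le_of_le_one_right (mul_nonneg (abs_nonneg _) (kern_nonneg n1 n2 ht')) f1
    have g2 : |B| * kern A (B - 1) b w t * ‖ContinuousLinearMap.snd ℝ ℝ ℝ‖
        ≤ |B| * kern A (B - 1) b w t :=
      mul_le_of_le_one_right (mul_nonneg (abs_nonneg _) (kern_nonneg n1 n2 ht')) f2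
    have h1 := mul_le_mul_of_nonneg_left k1 (abs_nonneg A)
    have h2 := mul_le_mul_of_nonneg_left k2 (abs_nonneg B)
    linarith
  · filter_upwards [ae_restrict_mem measurableSet_Ioi] with t ht w hw
    exact hasFDerivAt_kern A B b (hm.trans hw.1.1) (hm.trans hw.2.1) ht

lemma contDiffOn_kernInt (hb : 0 < b) (n : ℕ) : ∀ {A B : ℝ}, A + B + b < 0 →
    ContDiffOn ℝ n (kernInt A B b) {q | 0 < q.1 ∧ 0 < q.2} := by
  have hopen : IsOpen {q : ℝ × ℝ | 0 < q.1 ∧ 0 < q.2} :=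
    (isOpen_lt continuous_const continuous_fst).inter (isOpen_lt continuous_const continuous_snd)
  induction n with
  | zero =>
    intro A B hAB
    refine contDiffOn_zero.2 fun q hq => ?_
    exact (hasFDerivAt_kernInt hb hAB hq.1 hq.2).continuousAt.continuousWithinAt
  | succ n ih =>
    intro A B hAB
    push_cast
    rw [contDiffOn_succ_iff_fderiv_of_isOpen hopen]
    refine ⟨fun q hq =>
      (hasFDerivAt_kernInt hb hAB hq.1 hq.2).differentiableAt.differentiableWithinAt,
      fun h => absurd h (by simp), ?_⟩
    refine ContDiffOn.congr ?_ fun q hq => (hasFDerivAt_kernInt hb hAB hq.1 hq.2).fderiv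
    exact ((contDiffOn_const.mul (ih (by linarith))).smul contDiffOn_const).add
      ((contDiffOn_const.mul (ih (by linarith))).smul contDiffOn_const)

lemma hasDerivAt_kernInt_curve (hb : 0 < b) (hAB : A + B + b < 0) {r y : ℝ → ℝ} {r' y' w : ℝ}
    (hr : HasDerivAt r r' w) (hy : HasDerivAt y y' w) (h1 : 0 < r w) (h2 : 0 < y w) :
    HasDerivAt (fun w => kernInt A B b (r w, y w))
      (A * kernInt (A - 1) B b (r w, y w) * r' + B * kernInt A (B - 1) b (r w, y w) * y') w := by
  have := (hasFDerivAt_kernInt (q := (r w, y w)) hb hAB h1 h2).comp_hasDerivAt w (hr.prodMk hy)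
  exact this.congr_deriv (by simp)

lemma kern_le_of_nonneg {m M : ℝ} {q : ℝ × ℝ} (hm : 0 < m) (hm1 : m ≤ 1) (hM : 1 ≤ M)
    (h1 : q.1 ∈ Icc m M) (h2 : q.2 ∈ Icc 0 M) (A b : ℝ) (hB : 0 ≤ B) {t : ℝ} (ht : 0 ≤ t) :
    kern A B b q t ≤ (m ^ A + M ^ A) * M ^ B * ((1 + t) ^ (A + B) * t ^ (b - 1)) := by
  have hM0 : 0 < M := by linarith
  have k1 := add_rpow_le hm hm1 hM h1.1 h1.2 ht A
  have k2 : (q.2 + t) ^ B ≤ M ^ B * (1 + t) ^ B := by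
    rw [← Real.mul_rpow hM0.le (by linarith)]
    exact Real.rpow_le_rpow (add_nonneg h2.1 ht) (by nlinarith [h2.2]) hB
  have n2 : 0 ≤ (q.2 + t) ^ B := Real.rpow_nonneg (add_nonneg h2.1 ht) _
  calc kern A B b q t ≤ ((m ^ A + M ^ A) * (1 + t) ^ A) * (M ^ B * (1 + t) ^ B)
        * t ^ (b - 1) := by
        unfold kern; gcongr
    _ = _ := by rw [Real.rpow_add (by linarith : 0 < 1 + t)]; ring

lemma continuousOn_kernInt (hb : 0 < b) (hB : 0 ≤ B) (hAB : A + B + b < 0) :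
    ContinuousOn (kernInt A B b) {q | 0 < q.1 ∧ 0 ≤ q.2} := by
  intro q hq
  obtain ⟨h1, h2⟩ := hq
  obtain ⟨m, M, hm, hm1, hM, hq1, hq2⟩ := exists_box (q := (q.1, q.2 + 1)) h1 (by simp; linarith)
  simp only at hq1 hq2
  have hq2' : q.2 < M := by linarith [hq2.2]
  have hM0 : 0 < M := by linarith
  have hev : ∀ᶠ w in 𝓝[{q : ℝ × ℝ | 0 < q.1 ∧ 0 ≤ q.2}] q,
      w.1 ∈ Ioo m M ∧ w.2 ∈ Icc 0 M := by
    have e1 : ∀ᶠ w in 𝓝 q, w.1 ∈ Ioo m M :=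
      continuous_fst.continuousAt.eventually (Ioo_mem_nhds hq1.1 hq1.2)
    have e2 : ∀ᶠ w in 𝓝 q, w.2 < M := continuous_snd.continuousAt.eventually (gt_mem_nhds hq2')
    filter_upwards [self_mem_nhdsWithin, nhdsWithin_le_nhds e1, nhdsWithin_le_nhds e2]
      with w h3 h4 h5 using ⟨h4, h3.2, h5.le⟩
  refine continuousWithinAt_of_dominated (bound := fun t => (m ^ A + M ^ A) * M ^ B *
      ((1 + t) ^ (A + B) * t ^ (b - 1)))
    (Eventually.of_forall fun q => (measurable_kern A B b q).aestronglyMeasurable) ?_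
    ((integrableOn_one_add_rpow_mul hb hAB).const_mul _) ?_
  · filter_upwards [hev] with w hw
    filter_upwards [ae_restrict_mem measurableSet_Ioi] with t ht
    have ht0 : 0 < t := ht
    rw [Real.norm_of_nonneg (kern_nonneg (hm.le.trans hw.1.1.le) hw.2.1 ht0.le)]
    exact kern_le_of_nonneg hm hm1 hM (Ioo_subset_Icc_self hw.1) hw.2 A b hB ht0.le
  · filter_upwards [ae_restrict_mem measurableSet_Ioi] with t ht
    have ht0 : 0 < t := ht
    unfold kern
    refine ContinuousAt.continuousWithinAt ?_
    refine ((ContinuousAt.rpow_const (by fun_prop) (Or.inl ?_)).mul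
      (ContinuousAt.rpow_const (by fun_prop) (Or.inl ?_))).mul continuousAt_const <;> positivity

lemma kernInt_scale (A B b : ℝ) {l R y : ℝ} (hl : 0 < l) (hR : 0 ≤ R) (hy : 0 ≤ y) :
    kernInt A B b (l * R, l * y) = l ^ (A + B + b) * kernInt A B b (R, y) := by
  have h := integral_comp_mul_left_Ioi (fun t => kern A B b (l * R, l * y) t) 0 hl
  rw [mul_zero, smul_eq_mul, eq_inv_mul_iff_mul_eq₀ hl.ne'] at h
  unfold kernInt
  rw [← h, ← integral_const_mul, ← integral_const_mul]
  refine setIntegral_congr_fun measurableSet_Ioi fun t ht => ?_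
  have ht0 : 0 < t := ht
  simp only [kern]
  rw [← mul_add, ← mul_add, Real.mul_rpow hl.le (by positivity), Real.mul_rpow hl.le (by positivity),
    Real.mul_rpow hl.le ht0.le, Real.rpow_add hl, Real.rpow_add hl, Real.rpow_sub_one hl.ne']
  field_simp

lemma kernInt_pos (hb : 0 < b) (hB : 0 ≤ B) (hAB : A + B + b < 0) {q : ℝ × ℝ} (h1 : 0 < q.1)
    (h2 : 0 ≤ q.2) : 0 < kernInt A B b q := by
  obtain ⟨m, M, hm, hm1, hM, hq1, hq2⟩ := exists_box (q := (q.1, q.2 + 1)) h1 (by simp; linarith)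
  simp only at hq1 hq2
  have hinner : IntegrableOn (kern A B b q) (Ioi 0) := by
    refine Integrable.mono' ((integrableOn_one_add_rpow_mul hb hAB).const_mul
      ((m ^ A + M ^ A) * M ^ B)) (measurable_kern A B b q).aestronglyMeasurable ?_
    filter_upwards [ae_restrict_mem measurableSet_Ioi] with t ht
    rw [Real.norm_of_nonneg (kern_nonneg h1.le h2 (le_of_lt ht))]
    exact kern_le_of_nonneg hm hm1 hM (Ioo_subset_Icc_self hq1) ⟨h2, by linarith [hq2.2]⟩ A b hB
      (le_of_lt ht)
  refine (setIntegral_pos_iff_support_of_nonneg_ae ?_ hinner).2 ?_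
  · filter_upwards [ae_restrict_mem measurableSet_Ioi] with t ht
    exact kern_nonneg h1.le h2 (le_of_lt ht)
  · have hsub : Ioi (0 : ℝ) ⊆ Function.support (kern A B b q) :=
      fun t ht => (kern_pos h1.le h2 ht).ne'
    rw [inter_eq_self_of_subset_right hsub]
    simp

lemma kernInt_euler (hb : 0 < b) (hAB : A + B + b < 0) {R y : ℝ} (hR : 0 < R) (hy : 0 < y) :
    A * R * kernInt (A - 1) B b (R, y) + B * y * kernInt A (B - 1) b (R, y)
      = (A + B + b) * kernInt A B b (R, y) := by
  have hid := hasDerivAt_id (1 : ℝ)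
  have h1 := hasDerivAt_kernInt_curve hb hAB (hid.mul_const R) (hid.mul_const y)
    (by simpa using hR) (by simpa using hy)
  have h2 : HasDerivAt (fun l : ℝ => l ^ (A + B + b) * kernInt A B b (R, y))
      ((A + B + b) * kernInt A B b (R, y)) 1 :=
    ((Real.hasDerivAt_rpow_const (Or.inl one_ne_zero)).mul_const _).congr_deriv (by simp)
  have h3 := h1.unique (h2.congr_of_eventuallyEq ?_)
  · simp only [id, one_mul] at h3
    linarith
  · filter_upwards [lt_mem_nhds one_pos] with l hl
    exact kernInt_scale A B b hl hR.le hy.le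

lemma kernInt_sub_kernInt (hb : 0 < b) (hAB : A + B + b < 0) {R y : ℝ} (hR : 0 < R)
    (hy : 0 < y) : kernInt (A - 1) B b (R, y) - kernInt A (B - 1) b (R, y)
      = (y - R) * kernInt (A - 1) (B - 1) b (R, y) := by
  unfold kernInt
  rw [← integral_const_mul, ← integral_sub
    (integrableOn_kern (A := A - 1) (B := B) hb (by linarith) hR hy)
    (integrableOn_kern (A := A) (B := B - 1) hb (by linarith) hR hy)]
  refine setIntegral_congr_fun measurableSet_Ioi fun t ht => ?_
  have ht0 : 0 < t := ht
  have e1 : R + t ≠ 0 := by positivity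
  have e2 : y + t ≠ 0 := by positivity
  simp only [kern]
  rw [Real.rpow_sub_one e1, Real.rpow_sub_one e2]
  field_simp
  ring

lemma kernInt_second_order (hb : 0 < b) (hAB : A + B + b < 0) {R y : ℝ} (hR : 0 < R)
    (hy : 0 < y) : R * (A * (A - 1)) * kernInt (A - 1 - 1) B b (R, y)
      + 2 * (A * B) * y * kernInt (A - 1) (B - 1) b (R, y)
      + y * (B * (B - 1)) * kernInt A (B - 1 - 1) b (R, y)
      = (b + A - 1 + 2 * B) * A * kernInt (A - 1) B b (R, y)
        + (b + B - 1) * B * kernInt A (B - 1) b (R, y) := by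
  have h1 := kernInt_euler (A := A - 1) (B := B) hb (by linarith) hR hy
  have h2 := kernInt_euler (A := A) (B := B - 1) hb (by linarith) hR hy
  have h3 := kernInt_sub_kernInt hb hAB hR hy
  linear_combination A * h1 + B * h2 - A * B * h3

end Kernel

section Solution

lemma tendsto_kernInt_boundary {A B b : ℝ} (hb : 0 < b) (hA : A ≤ 0) (hBb : B + b < 0) {ρ : ℝ}
    (hρ : 0 < ρ) :
    Tendsto (fun y : ℝ => y ^ (-(B + b)) * kernInt A B b (ρ + y, y)) (𝓝[>] 0)
      (𝓝 (ρ ^ A * ∫ t in Ioi (0 : ℝ), (1 + t) ^ B * t ^ (b - 1))) := by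
  have key : ∀ y : ℝ, 0 < y → y ^ (-(B + b)) * kernInt A B b (ρ + y, y)
      = ∫ t in Ioi (0 : ℝ), (ρ + y + y * t) ^ A * ((1 + t) ^ B * t ^ (b - 1)) := by
    intro y hy
    have h := integral_comp_mul_left_Ioi (fun t => kern A B b (ρ + y, y) t) 0 hy
    rw [mul_zero, smul_eq_mul, eq_inv_mul_iff_mul_eq₀ hy.ne'] at h
    unfold kernInt
    rw [← h, ← integral_const_mul, ← integral_const_mul]
    refine setIntegral_congr_fun measurableSet_Ioi fun t ht => ?_
    have ht0 : 0 < t := ht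
    simp only [kern]
    rw [show y + y * t = y * (1 + t) by ring, Real.mul_rpow hy.le (by positivity),
      Real.mul_rpow hy.le ht0.le, Real.rpow_neg hy.le, Real.rpow_add hy, Real.rpow_sub_one hy.ne']
    field_simp
  rw [← integral_const_mul]
  refine Tendsto.congr' (f₁ := fun y : ℝ =>
    ∫ t in Ioi (0 : ℝ), (ρ + y + y * t) ^ A * ((1 + t) ^ B * t ^ (b - 1))) ?_ ?_
  · filter_upwards [self_mem_nhdsWithin] with y hy using (key y hy).symm
  refine tendsto_integral_filter_of_dominated_convergence
    (fun t => ρ ^ A * ((1 + t) ^ B * t ^ (b - 1))) ?_ ?_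
    ((integrableOn_one_add_rpow_mul hb hBb).const_mul _) ?_
  · refine Eventually.of_forall fun y => Measurable.aestronglyMeasurable ?_
    fun_prop
  · filter_upwards [self_mem_nhdsWithin] with y hy
    filter_upwards [ae_restrict_mem measurableSet_Ioi] with t ht
    have hy0 : 0 < y := hy
    have ht0 : 0 < t := ht
    have hyt : 0 < y * t := mul_pos hy0 ht0
    rw [Real.norm_of_nonneg (by positivity)]
    exact mul_le_mul_of_nonneg_right
      (Real.rpow_le_rpow_of_nonpos hρ (by linarith) hA) (by positivity)
  · filter_upwards with t
    refine Tendsto.mul_const _ ?_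
    have hc : ContinuousAt (fun y : ℝ => (ρ + y + y * t) ^ A) 0 :=
      ContinuousAt.rpow_const (by fun_prop) (Or.inl (by simpa using hρ.ne'))
    simpa using hc.tendsto.mono_left nhdsWithin_le_nhds

lemma integral_one_add_rpow_mul_pos {B b : ℝ} (hb : 0 < b) (hBb : B + b < 0) :
    0 < ∫ t in Ioi (0 : ℝ), (1 + t) ^ B * t ^ (b - 1) := by
  have hpos : ∀ t ∈ Ioi (0 : ℝ), 0 < (1 + t) ^ B * t ^ (b - 1) := by
    intro t ht
    have ht0 : 0 < t := ht
    positivity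
  refine (setIntegral_pos_iff_support_of_nonneg_ae ?_
    (integrableOn_one_add_rpow_mul hb hBb)).2 ?_
  · filter_upwards [ae_restrict_mem measurableSet_Ioi] with t ht using (hpos t ht).le
  · have hsub : Ioi (0 : ℝ) ⊆ Function.support fun t : ℝ => (1 + t) ^ B * t ^ (b - 1) :=
      fun t ht => (hpos t ht).ne'
    rw [inter_eq_self_of_subset_right hsub]
    simp

/-- The function `c ∫₀^∞ (|x|² + z² + t)^A (z² + t)^B t^(b-1) dt` on the half-space. -/
noncomputable def kernSol (N : ℕ) (A B b c : ℝ) (q : Euc N × ℝ) : ℝ :=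
  c * kernInt A B b (‖q.1‖ ^ 2 + q.2 ^ 2, q.2 ^ 2)

variable {N : ℕ} {A B b c : ℝ}

lemma continuousOn_kernSol (hb : 0 < b) (hB : 0 ≤ B) (hAB : A + B + b < 0) :
    ContinuousOn (kernSol N A B b c) ({q : Euc N × ℝ | 0 ≤ q.2} \ {0}) := by
  refine continuousOn_const.mul ((continuousOn_kernInt hb hB hAB).comp
    (f := fun q : Euc N × ℝ => (‖q.1‖ ^ 2 + q.2 ^ 2, q.2 ^ 2)) (by fun_prop) ?_)
  exact fun q hq => ⟨radius_sq_pos hq.2, sq_nonneg _⟩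

lemma contDiffOn_kernSol (hb : 0 < b) (hAB : A + B + b < 0) :
    ContDiffOn ℝ 2 (kernSol N A B b c) {q | 0 < q.2} := by
  have h2 : ContDiff ℝ 2 fun q : Euc N × ℝ => (‖q.1‖ ^ 2 + q.2 ^ 2, q.2 ^ 2) :=
    contDiff_radius_sq.prodMk (contDiff_snd.pow 2)
  refine contDiffOn_const.mul ((contDiffOn_kernInt hb 2 hAB).comp h2.contDiffOn ?_)
  intro q hq
  have hq0 : 0 < q.2 := hq
  exact ⟨by positivity, by positivity⟩

lemma hasDerivAt_kernSol_vertical (hb : 0 < b) (hAB : A + B + b < 0) (x : Euc N) {z : ℝ}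
    (hz : 0 < z) : HasDerivAt (fun w => kernSol N A B b c (x, w))
      (c * (A * kernInt (A - 1) B b (‖x‖ ^ 2 + z ^ 2, z ^ 2)
        + B * kernInt A (B - 1) b (‖x‖ ^ 2 + z ^ 2, z ^ 2)) * (2 * z)) z := by
  have hsq : HasDerivAt (fun w : ℝ => w ^ 2) (2 * z) z := by simpa using hasDerivAt_pow 2 z
  have := (hasDerivAt_kernInt_curve hb hAB (hsq.const_add (‖x‖ ^ 2)) hsq
    (by positivity) (by positivity)).const_mul c
  exact this.congr_deriv (by ring)

lemma CSop_kernSol {s : ℝ} (hb : 0 < b) (hAB : A + B + b < 0) (hbB : b + B = s)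
    (hN : b + A + 2 * B + N / 2 = s) {q : Euc N × ℝ} (hq : 0 < q.2) :
    CSop N s (kernSol N A B b c) q = 0 := by
  obtain ⟨x, z⟩ := q
  have hz : 0 < z := hq
  have hsq : HasDerivAt (fun w : ℝ => w ^ 2) (2 * z) z := by simpa using hasDerivAt_pow 2 z
  have hρ : 0 ≤ ‖x - 0‖ ^ 2 := by positivity
  have hg : ∀ {A B : ℝ}, A + B + b < 0 → ∀ {r : ℝ}, 0 < r + z ^ 2 →
      HasDerivAt (fun r => kernInt A B b (r + z ^ 2, z ^ 2))
        (A * kernInt (A - 1) B b (r + z ^ 2, z ^ 2)) r := by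
    intro A B hAB r hr
    have := hasDerivAt_kernInt_curve hb hAB ((hasDerivAt_id r).add_const (z ^ 2))
      (hasDerivAt_const r (z ^ 2)) hr (by positivity)
    exact this.congr_deriv (by simp)
  have hv : ∀ {A B : ℝ}, A + B + b < 0 →
      HasDerivAt (fun w => kernInt A B b (‖x‖ ^ 2 + w ^ 2, w ^ 2))
        ((A * kernInt (A - 1) B b (‖x‖ ^ 2 + z ^ 2, z ^ 2)
          + B * kernInt A (B - 1) b (‖x‖ ^ 2 + z ^ 2, z ^ 2)) * (2 * z)) z := by
    intro A B hAB
    have := hasDerivAt_kernInt_curve hb hAB (hsq.const_add (‖x‖ ^ 2)) hsq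
      (by positivity) (by positivity)
    exact this.congr_deriv (by ring)
  rw [CSop_eq_of_radial s (contDiffAt_of_upper (contDiffOn_kernSol hb hAB) hz) 0
    (g := fun r => c * kernInt A B b (r + z ^ 2, z ^ 2))
    (g₁ := fun r => c * (A * kernInt (A - 1) B b (r + z ^ 2, z ^ 2)))
    (fun x' => by simp [kernSol])
    ((lt_mem_nhds (by linarith [sq_pos_of_pos hz] : -(z ^ 2) < ‖x - 0‖ ^ 2)).mono
      fun r hr => (hg hAB (by linarith)).const_mul c)
    (((hg (A := A - 1) (B := B) (by linarith) (by positivity)).const_mul A).const_mul c)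
    ((lt_mem_nhds hz).mono fun w hw => hasDerivAt_kernSol_vertical hb hAB x hw)
    (((((hv (A := A - 1) (B := B) (by linarith)).const_mul A).add
      ((hv (A := A) (B := B - 1) (by linarith)).const_mul B)).const_mul c).mul
      ((hasDerivAt_id z).const_mul 2)), rpow_neg_two_mul hz]
  have hid := kernInt_second_order hb hAB (by positivity : 0 < ‖x‖ ^ 2 + z ^ 2)
    (by positivity : 0 < z ^ 2)
  have hzz : z ^ (1 - 2 * s) / z * z = z ^ (1 - 2 * s) := div_mul_cancel₀ _ hz.ne'
  have hB' : B = s - b := by linarith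
  have hN' : (N : ℝ) = 2 * (s - b - A - 2 * B) := by linarith
  simp only [sub_zero, Pi.add_apply]
  rw [hN']
  generalize z ^ (1 - 2 * s) / z = P at hzz ⊢
  rw [← hzz]
  subst hB'
  linear_combination 4 * c * P * z * hid

lemma tendsto_kernSol_conormal {s : ℝ} (hs : s < 1) (hb : 0 < b) (hB : 0 ≤ B) (hA : A ≤ 0)
    (hbB : b + B = s) (hAB : A + B + b < 0) {x : Euc N} (hx : x ≠ 0) :
    Tendsto (fun z : ℝ => z ^ (1 - 2 * s)
        * fderiv ℝ (kernSol N A B b c) (x, z) ((0 : Euc N), (1 : ℝ))) (𝓝[>] 0)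
      (𝓝 (2 * c * B * ((‖x‖ ^ 2) ^ A
        * ∫ t in Ioi (0 : ℝ), (1 + t) ^ (B - 1) * t ^ (b - 1)))) := by
  have hρ : 0 < ‖x‖ ^ 2 := by positivity
  have hsq : Tendsto (fun z : ℝ => z ^ 2) (𝓝[>] 0) (𝓝[>] 0) := by
    refine tendsto_nhdsWithin_iff.2 ⟨?_, ?_⟩
    · have : ContinuousAt (fun z : ℝ => z ^ 2) 0 := by fun_prop
      simpa using this.tendsto.mono_left nhdsWithin_le_nhds
    · filter_upwards [self_mem_nhdsWithin] with z hz
      have hz0 : 0 < z := hz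
      exact pow_pos hz0 2
  have h1 := (tendsto_kernInt_boundary (B := B - 1) hb hA (by linarith) hρ).comp hsq
  have h2 : Tendsto (fun z : ℝ => kernInt (A - 1) B b (‖x‖ ^ 2 + z ^ 2, z ^ 2)) (𝓝[>] 0)
      (𝓝 (kernInt (A - 1) B b (‖x‖ ^ 2 + 0 ^ 2, 0 ^ 2))) := by
    have hmem : ((‖x‖ ^ 2 + 0 ^ 2, 0 ^ 2) : ℝ × ℝ) ∈ {q : ℝ × ℝ | 0 < q.1 ∧ 0 ≤ q.2} :=
      ⟨by simp only [ne_eq, OfNat.ofNat_ne_zero, not_false_eq_true, zero_pow, add_zero]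
          positivity, by simp⟩
    refine (continuousOn_kernInt (A := A - 1) hb hB (by linarith) _ hmem).tendsto.comp ?_
    refine tendsto_nhdsWithin_iff.2 ⟨?_, ?_⟩
    · have : ContinuousAt (fun z : ℝ => (‖x‖ ^ 2 + z ^ 2, z ^ 2)) 0 := by fun_prop
      exact this.tendsto.mono_left nhdsWithin_le_nhds
    · exact Eventually.of_forall fun z => ⟨by positivity, by positivity⟩
  have h3 : Tendsto (fun z : ℝ => z ^ (2 - 2 * s)) (𝓝[>] 0) (𝓝 0) := by
    have := (Real.continuousAt_rpow_const 0 (2 - 2 * s) (Or.inr (by linarith))).tendsto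
    rw [Real.zero_rpow (by linarith)] at this
    exact this.mono_left nhdsWithin_le_nhds
  have h4 := ((h3.mul h2).const_mul (2 * c * A)).add (h1.const_mul (2 * c * B))
  rw [zero_mul, mul_zero, zero_add] at h4
  refine h4.congr' ?_
  filter_upwards [self_mem_nhdsWithin] with z hz
  have hz0 : 0 < z := hz
  rw [(hasDerivAt_vertical ((contDiffAt_of_upper (contDiffOn_kernSol hb hAB) hz0).differentiableAt
    (by norm_num))).unique (hasDerivAt_kernSol_vertical hb hAB x hz0)]
  have e1 : z ^ (2 - 2 * s) = z ^ (1 - 2 * s) * z := by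
    rw [← Real.rpow_add_one hz0.ne']; congr 1; ring
  have e2 : (z ^ 2) ^ (-(B - 1 + b)) = z ^ (1 - 2 * s) * z := by
    rw [← e1, ← Real.rpow_natCast, ← Real.rpow_mul hz0.le]; congr 1; push_cast; linarith
  simp only [Function.comp, e1, e2]
  ring

lemma exists_selfSimPos {s p : ℝ} (hs : s ∈ Ioo (0 : ℝ) 1) (hp : 1 < p)
    (h1 : (N : ℝ) / 2 - s < s / (p - 1)) (h2 : s / (p - 1) < N / 2) :
    ∃ u ∈ SelfSimPos N s p 1, (∀ q : Euc N × ℝ, 0 ≤ q.2 → q ≠ 0 → 0 < u q) ∧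
      ∀ (x x' : Euc N) (z : ℝ), ‖x‖ = ‖x'‖ → u (x, z) = u (x', z) := by
  obtain ⟨hs0, hs1⟩ := hs
  have hp0 : 0 < p - 1 := by linarith
  set a : ℝ := s / (p - 1) with ha
  have ha0 : 0 < a := div_pos hs0 hp0
  have hap : a * p = a + s := by rw [ha]; field_simp; ring
  set b : ℝ := N / 2 - a with hbdef
  set B : ℝ := s - b with hBdef
  set A : ℝ := -(a + s) with hAdef
  have hb : 0 < b := by linarith
  have hB : 0 < B := by linarith
  have hsum : A + B + b = -a := by linarith
  have hAB : A + B + b < 0 := by linarith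
  set J : ℝ := ∫ t in Ioi (0 : ℝ), (1 + t) ^ (B - 1) * t ^ (b - 1) with hJ
  have hJ0 : 0 < J := integral_one_add_rpow_mul_pos hb (by linarith)
  set W : ℝ := kernInt A B b (1, 0) with hW
  have hW0 : 0 < W := kernInt_pos hb hB.le hAB one_pos le_rfl
  set K : ℝ := 2 * B * J with hK
  have hK0 : 0 < K := by positivity
  set c : ℝ := (K / W ^ p) ^ (1 / (p - 1)) with hc
  have hc0 : 0 < c := by positivity
  have hcp : c ^ p * W ^ p = c * K := by
    have e : c ^ (p - 1) = K / W ^ p := by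
      rw [hc, ← Real.rpow_mul (by positivity), one_div_mul_cancel hp0.ne', Real.rpow_one]
    rw [Real.rpow_sub_one hc0.ne'] at e
    have : 0 < W ^ p := by positivity
    field_simp at e
    linarith
  refine ⟨kernSol N A B b c, ⟨⟨continuousOn_kernSol hb hB.le hAB, contDiffOn_kernSol hb hAB,
    ?_, fun q hq => CSop_kernSol hb hAB (by linarith) (by linarith) hq, ?_⟩, ?_⟩, ?_, ?_⟩
  · intro l hl q
    have e : l ^ (-(2 * s) / (p - 1)) = (l ^ 2) ^ (A + B + b) := by
      have := rpow_scale (p := p) (s := s) hl zero_le_one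
      rw [mul_one, Real.one_rpow, mul_one] at this
      rw [hsum, ← this]
    simp only [kernSol]
    rw [e, norm_smul, Real.norm_of_nonneg hl.le, mul_pow, mul_pow, ← mul_add,
      kernInt_scale A B b (by positivity) (by positivity) (by positivity)]
    ring
  · intro x hx
    have hρ : 0 < ‖x‖ ^ 2 := by positivity
    have hval : kernSol N A B b c (x, 0) = c * W * (‖x‖ ^ 2) ^ (-a) := by
      have := kernInt_scale A B b hρ zero_le_one le_rfl
      simp only [mul_one, mul_zero, hsum] at this
      simp only [kernSol]
      rw [zero_pow two_ne_zero, add_zero, this]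
      ring
    have hpos : 0 < kernSol N A B b c (x, 0) := by rw [hval]; positivity
    have hlim : 1 * |kernSol N A B b c (x, 0)| ^ (p - 1) * kernSol N A B b c (x, 0)
        = 2 * c * B * ((‖x‖ ^ 2) ^ A * J) := by
      rw [abs_of_pos hpos, one_mul, ← Real.rpow_add_one hpos.ne', sub_add_cancel, hval,
        Real.mul_rpow (by positivity) (by positivity), Real.mul_rpow hc0.le hW0.le, hcp,
        ← Real.rpow_mul hρ.le, show -a * p = A by linarith]
      ring
    rw [hlim]
    exact tendsto_kernSol_conormal hs1 hb hB.le (by linarith) (by linarith) hAB hx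
  · intro q _
    exact mul_nonneg hc0.le (setIntegral_nonneg measurableSet_Ioi fun t ht =>
      kern_nonneg (by positivity) (by positivity) (le_of_lt ht))
  · intro q _ hq
    exact mul_pos hc0 (kernInt_pos hb hB.le hAB (radius_sq_pos hq) (sq_nonneg _))
  · intro x x' z h
    simp [kernSol, h]

end Solution

/-- Theorem A, part 3: if `1 + 2s/N < p < N/(N-2s)` then
`E₁⁺ = {0, u₁}` with `u₁` strictly positive and radial in the `x`-variable. -/
theorem stmt4 (N : ℕ) (hN : 1 ≤ N) (s p : ℝ) (hs : s ∈ Set.Ioo (0:ℝ) 1)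
    (h2s : 2*s < N) (hp1 : 1 + 2*s/N < p) (hp2 : p < (N:ℝ)/((N:ℝ) - 2*s)) :
    ∃ u₁ ∈ SelfSimPos N s p 1,
      (∀ q : Euc N × ℝ, 0 ≤ q.2 → q ≠ 0 → 0 < u₁ q) ∧
      (∀ (x x' : Euc N) (z : ℝ), ‖x‖ = ‖x'‖ → u₁ (x, z) = u₁ (x', z)) ∧
      (∀ u ∈ SelfSimPos N s p 1,
        (∀ q : Euc N × ℝ, 0 ≤ q.2 → q ≠ 0 → u q = 0) ∨
        (∀ q : Euc N × ℝ, 0 ≤ q.2 → q ≠ 0 → u q = u₁ q)) := by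
  have hs0 := hs.1
  have hN0 : (0 : ℝ) < N := by exact_mod_cast hN
  have hquot : 0 < 2 * s / N := by positivity
  have hp : 1 < p := by linarith
  have hp0 : 0 < p - 1 := by linarith
  have hlow : (N : ℝ) / 2 - s < s / (p - 1) := by
    rw [lt_div_iff₀ (by linarith)] at hp2
    rw [lt_div_iff₀ hp0]
    linarith
  have hup : s / (p - 1) < N / 2 := by
    have h := (div_lt_iff₀ hN0).1 (show 2 * s / N < p - 1 by linarith)
    rw [div_lt_iff₀ hp0]
    linarith
  obtain ⟨u₁, hu₁, hpos, hrad⟩ := exists_selfSimPos (N := N) hs hp hlow hup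
  refine ⟨u₁, hu₁, hpos, hrad, fun u hu => ?_⟩
  by_cases hne : ∃ q : Euc N × ℝ, 0 ≤ q.2 ∧ q ≠ 0 ∧ u q ≠ 0
  · have hupos := selfSimPos_pos_of_ne_zero hN hs hu hne
    have hsub : ((N : ℝ) - 2 * s) / 2 < s / (p - 1) := by linarith
    exact Or.inr fun q hq hq0 => le_antisymm (selfSimPos_le hs hp hsub hu hu₁.1 hpos q hq hq0)
      (selfSimPos_le hs hp hsub hu₁ hu.1 hupos q hq hq0)
  · push Not at hne
    exact Or.inl hne
end
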